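/- arXiv:1210.7840 — 4 statements merged into one kernel-verified Lean document; each statement's English description precedes it below -/
import Mathlib

section
/- Let F be a CM number field with maximal totally real subfield K of degree k over ℚ. There exists a finite set E of nonzero elements of O_F with the following property: whenever κ ∈ O_F is nonzero and α ∈ κO_F is a nonzero element minimal over the principal ideal κO_F for some choice of positive weights x_1, …, x_k, there exist a unit u ∈ O_F^× and an element η ∈ E such that α = κ·u·η, and moreover η is minimal over O_F for some choice of positive weights. -/
open NumberField Finset

/-- The map `Σ : F → ℝ^k`, `α ↦ (σ₁(αᾱ), …, σ_k(αᾱ))`, expressed via the relative norm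
`nm : F → K`, `nm α = α·conj α` (viewed in `K`). -/
noncomputable def SigmaMap {F K : Type*} [Field F] [Field K] {k : ℕ}
    (σ : Fin k → (K →+* ℝ)) (nm : F → K) (α : F) : Fin k → ℝ :=
  fun j => σ j (nm α)

/-- The weighted norm `⟨α,α⟩_x = ∑_j x_j σ_j(αᾱ)`. -/
noncomputable def weightedNorm {F K : Type*} [Field F] [Field K] {k : ℕ}
    (σ : Fin k → (K →+* ℝ)) (nm : F → K) (x : Fin k → ℝ) (α : F) : ℝ :=
  ∑ j, x j * σ j (nm α)

/-- The field norm `N_ℚ(α) = ∏_j σ_j(αᾱ)`. -/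
noncomputable def fieldNormQ {F K : Type*} [Field F] [Field K] {k : ℕ}
    (σ : Fin k → (K →+* ℝ)) (nm : F → K) (α : F) : ℝ :=
  ∏ j, σ j (nm α)

/-- The `i`-th vertex `Σ(g_{s(1)} ⋯ g_{s(i)})` of the simplex `Σ(Δ_s)`. -/
noncomputable def simplexVertex {F K : Type*} [Field F] [Field K] {m : ℕ}
    (σ : Fin (m + 1) → (K →+* ℝ)) (nm : F → K) (g : Fin m → (𝓞 F)ˣ)
    (s : Equiv.Perm (Fin m)) (i : Fin (m + 1)) : Fin (m + 1) → ℝ :=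
  SigmaMap σ nm (∏ l ∈ Finset.univ.filter (fun l : Fin m => (l : ℕ) < (i : ℕ)),
    ((g (s l) : 𝓞 F) : F))

/-- The `k×k` matrix `A_s` whose rows are the vertices of the simplex `Σ(Δ_s)`. -/
noncomputable def matA {F K : Type*} [Field F] [Field K] {m : ℕ}
    (σ : Fin (m + 1) → (K →+* ℝ)) (nm : F → K) (g : Fin m → (𝓞 F)ˣ)
    (s : Equiv.Perm (Fin m)) : Matrix (Fin (m + 1)) (Fin (m + 1)) ℝ :=
  Matrix.of fun i j => simplexVertex σ nm g s i j

/-- The `(k-1)×(k-1)` matrix `B_{s,l}`: consecutive vertex differences with the `l`-th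
column deleted. -/
noncomputable def matB {F K : Type*} [Field F] [Field K] {m : ℕ}
    (σ : Fin (m + 1) → (K →+* ℝ)) (nm : F → K) (g : Fin m → (𝓞 F)ˣ)
    (s : Equiv.Perm (Fin m)) (l : Fin (m + 1)) : Matrix (Fin m) (Fin m) ℝ :=
  Matrix.of fun r c =>
    simplexVertex σ nm g s r.succ (l.succAbove c) -
      simplexVertex σ nm g s r.castSucc (l.succAbove c)

/-- The bound `max_s |(det A_s / k)^k ∏_l (det B_{s,l})⁻¹|`. -/
noncomputable def simplexBound {F K : Type*} [Field F] [Field K] {m : ℕ}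
    (σ : Fin (m + 1) → (K →+* ℝ)) (nm : F → K) (g : Fin m → (𝓞 F)ˣ) : ℝ :=
  Finset.univ.sup' Finset.univ_nonempty fun s : Equiv.Perm (Fin m) =>
    |((matA σ nm g s).det / (m + 1)) ^ (m + 1) * ∏ l, ((matB σ nm g s l).det)⁻¹|


open NumberField.InfinitePlace MeasureTheory NumberField.mixedEmbedding in
open scoped Classical in
theorem aux_minkowski (F : Type*) [Field F] [NumberField F] (hC : ∀ w : InfinitePlace F, IsComplex w) :
    ∃ B : ℕ, ∀ (y : InfinitePlace F → ℝ), (∀ w, 0 < y w) → ∀ η : 𝓞 F,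
      (∀ β : 𝓞 F, β ≠ 0 → ∑ w, y w * (w (η : F)) ^ 2 ≤ ∑ w, y w * (w (β : F)) ^ 2) →
      Ideal.absNorm (Ideal.span {η}) ≤ B := by
  set k := Fintype.card (InfinitePlace F) with hk
  have hk0 : k ≠ 0 := Fintype.card_ne_zero
  have hmult : ∀ w : InfinitePlace F, mult w = 2 := fun w => by
    simp [mult, not_isReal_iff_isComplex.mpr (hC w)]
  set M : NNReal := (minkowskiBound F ↑1).toNNReal + 1 with hM
  have hMpos : 0 < M := by positivity
  refine ⟨⌈(k : ℝ) ^ k * M⌉₊, fun y hy η hmin => ?_⟩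
  have hP : 0 < ∏ w, y w := Finset.prod_pos fun w _ => hy w
  set c : ℝ := ((M : ℝ) * ∏ w, y w) ^ ((k : ℝ)⁻¹) with hc
  have hMr : (0 : ℝ) < M := by exact_mod_cast hMpos
  have hcpos : 0 < c := by positivity
  have hck : c ^ k = M * ∏ w, y w := by
    rw [hc, Real.rpow_inv_natCast_pow (by positivity) hk0]
  let f : InfinitePlace F → NNReal := fun w => ⟨Real.sqrt (c / y w), Real.sqrt_nonneg _⟩
  have hf2 : ∀ w, ((f w : ℝ)) ^ 2 = c / y w := fun w => by
    have := hy w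
    exact Real.sq_sqrt (by positivity)
  have hfprod : ∏ w, (f w) ^ (mult w) = M := by
    apply NNReal.coe_injective
    push_cast
    simp_rw [hmult, hf2]
    rw [Finset.prod_div_distrib, Finset.prod_const, Finset.card_univ, ← hk, hck]
    field_simp
  have hvol : minkowskiBound F ↑1 < volume (convexBodyLT F f) := by
    rw [convexBodyLT_volume]
    have h1 : minkowskiBound F ↑1 < (M : ENNReal) := by
      rw [hM]
      push_cast
      rw [ENNReal.coe_toNNReal (minkowskiBound_lt_top F _).ne]
      exact ENNReal.lt_add_right (minkowskiBound_lt_top F _).ne one_ne_zero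
    refine h1.trans_le ?_
    rw [hfprod]
    have h3 : (1 : ENNReal) ≤ convexBodyLTFactor F := by
      exact_mod_cast one_le_convexBodyLTFactor F
    exact le_mul_of_one_le_left zero_le h3
  obtain ⟨β, hβ0, hβ⟩ := exists_ne_zero_mem_ringOfIntegers_lt F hvol
  have hsum : ∑ w, y w * (w (β : F)) ^ 2 ≤ k * c := by
    have : ∀ w ∈ (Finset.univ : Finset (InfinitePlace F)), y w * (w (β : F)) ^ 2 ≤ c := by
      intro w _
      have h1 : (w (β : F)) ^ 2 ≤ c / y w := by
        rw [← hf2]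
        exact pow_le_pow_left₀ (apply_nonneg w _) (hβ w).le 2
      have h2 := hy w
      calc y w * (w (β : F)) ^ 2 ≤ y w * (c / y w) := by gcongr
        _ = c := by field_simp
    refine (Finset.sum_le_sum this).trans ?_
    simp [hk]
  have hη : ∀ w, y w * (w (η : F)) ^ 2 ≤ k * c := fun w =>
    (Finset.single_le_sum (f := fun w => y w * (w (η : F)) ^ 2)
      (fun w _ => mul_nonneg (hy w).le (sq_nonneg _)) (Finset.mem_univ w)).trans
      ((hmin β hβ0).trans hsum)
  have hprod : ∏ w, (y w * (w (η : F)) ^ 2) ≤ (k * c) ^ k := by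
    refine (Finset.prod_le_prod (fun w _ => mul_nonneg (hy w).le (sq_nonneg _))
      (fun w _ => hη w)).trans ?_
    simp [hk]
  rw [Finset.prod_mul_distrib, mul_pow, hck] at hprod
  have hN : ∏ w : InfinitePlace F, (w (η : F)) ^ 2 ≤ (k : ℝ) ^ k * M := by
    have : (∏ w, y w) * ∏ w : InfinitePlace F, (w (η : F)) ^ 2 ≤ (∏ w, y w) * ((k : ℝ) ^ k * M) := by
      refine hprod.trans (le_of_eq (by ring))
    exact le_of_mul_le_mul_left this hP
  have hnorm := InfinitePlace.prod_eq_abs_norm (K := F) (η : F)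
  simp_rw [hmult] at hnorm
  rw [hnorm] at hN
  have : ((Ideal.absNorm (Ideal.span {η}) : ℕ) : ℝ) ≤ (k : ℝ) ^ k * M := by
    refine le_trans (le_of_eq ?_) hN
    rw [Ideal.absNorm_span_singleton, ← Algebra.coe_norm_int, Nat.cast_natAbs]
    push_cast
    rfl
  exact_mod_cast this.trans (Nat.le_ceil _)

theorem aux_conj {F K : Type*} [Field F] [Field K] [NumberField F] [NumberField K] [Algebra K F]
    (hTI : IsEmpty (F →+* ℝ)) (hquad : Module.finrank K F = 2)
    (conj : F ≃ₐ[K] F) (hconj : conj ≠ AlgEquiv.refl)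
    (s : K →+* ℝ) (φ : F →+* ℂ) (h : ∀ x, φ (algebraMap K F x) = (s x : ℂ))
    (nm : F → K) (hnm : ∀ α : F, algebraMap K F (nm α) = α * conj α) (α : F) :
    s (nm α) = ‖φ α‖ ^ 2 := by
  haveI : Algebra.IsQuadraticExtension K F := ⟨hquad⟩
  obtain ⟨g, hg⟩ := ComplexEmbedding.exists_comp_symm_eq_of_comp_eq (k := K) φ
    ((starRingEnd ℂ).comp φ) (by ext x; simp [h])
  have hcard : Nat.card (F ≃ₐ[K] F) = 2 := hquad ▸ IsGalois.card_aut_eq_finrank K F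
  rw [Nat.card_eq_two_iff' 1] at hcard
  have hg1 : g.symm ≠ 1 := by
    intro h1
    have hreal : ComplexEmbedding.IsReal φ := by
      rw [ComplexEmbedding.isReal_iff]
      ext x
      have := RingHom.congr_fun hg x
      rw [h1] at this
      simpa using this.symm
    exact hTI.false hreal.embedding
  have hgc : g.symm = conj := hcard.unique hg1 hconj
  have h2 : φ (conj α) = starRingEnd ℂ (φ α) := by
    rw [← hgc]
    exact RingHom.congr_fun hg α
  have h3 : ((s (nm α) : ℝ) : ℂ) = ((‖φ α‖ ^ 2 : ℝ) : ℂ) := by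
    rw [← h, hnm, map_mul, h2, Complex.mul_conj']
    push_cast
    rfl
  exact_mod_cast h3

theorem exists_finite_characteristic_set
    {F K : Type*} [Field F] [Field K] [NumberField F] [NumberField K] [Algebra K F]
    -- `K` is totally real
    (hTR : ∀ τ : K →+* ℂ, ∀ x : K, (τ x).im = 0)
    -- `F` is totally imaginary
    (hTI : IsEmpty (F →+* ℝ))
    -- `F/K` is quadratic, so `F` is a CM field with maximal totally real subfield `K`
    (hquad : Module.finrank K F = 2)
    -- complex conjugation: the nontrivial element of `Gal(F/K)`
    (conj : F ≃ₐ[K] F) (hconj : conj ≠ AlgEquiv.refl)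
    -- `k = m + 1` is the degree of `K` over `ℚ`
    (m : ℕ) (hk : Module.finrank ℚ K = m + 1)
    -- the `k` real embeddings of `K`
    (σ : Fin (m + 1) → (K →+* ℝ)) (hσ : Function.Bijective σ)
    -- the relative norm `α ↦ α·conj α`, valued in `K`
    (nm : F → K) (hnm : ∀ α : F, algebraMap K F (nm α) = α * conj α) :
    ∃ E : Finset (𝓞 F), (∀ η ∈ E, η ≠ 0) ∧
      ∀ κ : 𝓞 F, κ ≠ 0 → ∀ α ∈ Ideal.span {κ}, α ≠ 0 →
        (∃ x : Fin (m + 1) → ℝ, (∀ j, 0 < x j) ∧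
          ∀ β : 𝓞 F, β ≠ 0 → β ∈ Ideal.span {κ} →
            weightedNorm σ nm x (α : F) ≤ weightedNorm σ nm x (β : F)) →
        ∃ u : (𝓞 F)ˣ, ∃ η ∈ E, α = κ * (u : 𝓞 F) * η ∧
          ∃ y : Fin (m + 1) → ℝ, (∀ j, 0 < y j) ∧
            ∀ β : 𝓞 F, β ≠ 0 →
              weightedNorm σ nm y (η : F) ≤ weightedNorm σ nm y (β : F) := by
  classical
  have hkey := fun s φ h α => aux_conj hTI hquad conj hconj s φ h nm hnm α
  have hC : ∀ w : InfinitePlace F, InfinitePlace.IsComplex w := by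
    intro w
    rw [← InfinitePlace.not_isReal_iff_isComplex]
    intro hw
    exact hTI.false (InfinitePlace.embedding_of_isReal hw)
  have hJ : ∀ w : InfinitePlace F, ∃ j, ∀ x, w.embedding (algebraMap K F x) = (σ j x : ℂ) := by
    intro w
    have hreal : ComplexEmbedding.IsReal (w.embedding.comp (algebraMap K F)) := by
      rw [ComplexEmbedding.isReal_iff]
      ext x
      exact Complex.conj_eq_iff_im.mpr (hTR _ x)
    obtain ⟨j, hj⟩ := hσ.2 hreal.embedding
    refine ⟨j, fun x => ?_⟩
    rw [hj, ComplexEmbedding.IsReal.coe_embedding_apply]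
    rfl
  choose J hJ using hJ
  have hJw : ∀ w (α : F), (w α) ^ 2 = σ (J w) (nm α) := by
    intro w α
    rw [hkey _ _ (hJ w), InfinitePlace.norm_embedding_eq]
  have hJb : Function.Bijective J := by
    constructor
    · intro w w' hww
      ext α
      have h1 := hJw w α
      have h2 := hJw w' α
      rw [hww, ← h2] at h1
      exact (pow_left_inj₀ (apply_nonneg w _) (apply_nonneg w' _) two_ne_zero).mp h1
    · intro j
      let φ : F →+* ℂ := ComplexEmbedding.lift F (Complex.ofRealHom.comp (σ j))
      have hφ : ∀ x, φ (algebraMap K F x) = (σ j x : ℂ) := fun x => by simp [φ]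
      refine ⟨InfinitePlace.mk φ, hσ.1 ?_⟩
      ext x
      have h1 := hJ (InfinitePlace.mk φ) x
      rcases InfinitePlace.embedding_mk_eq φ with h | h
      · rw [h, hφ] at h1
        exact_mod_cast h1.symm
      · rw [h, ComplexEmbedding.conjugate_coe_eq, hφ, Complex.conj_ofReal] at h1
        exact_mod_cast h1.symm
  have hwn : ∀ (y : Fin (m + 1) → ℝ) (α : F),
      weightedNorm σ nm y α = ∑ w, y (J w) * (w α) ^ 2 := by
    intro y α
    simp_rw [hJw]
    exact (hJb.sum_comp (fun j => y j * σ j (nm α))).symm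
  have hmul : ∀ a b : F, nm (a * b) = nm a * nm b := by
    intro a b
    apply (algebraMap K F).injective
    rw [map_mul, hnm, hnm, hnm, map_mul]
    ring
  have hpos : ∀ j (a : F), a ≠ 0 → 0 < σ j (nm a) := by
    intro j a ha
    obtain ⟨w, rfl⟩ := hJb.2 j
    rw [← hJw]
    have : 0 < w a := InfinitePlace.pos_iff.mpr ha
    positivity
  obtain ⟨B, hB⟩ := aux_minkowski F hC
  let P : 𝓞 F → Prop := fun η => ∃ y : Fin (m + 1) → ℝ, (∀ j, 0 < y j) ∧
            ∀ β : 𝓞 F, β ≠ 0 →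
              weightedNorm σ nm y (η : F) ≤ weightedNorm σ nm y (β : F)
  have hfin := Ideal.finite_setOfPred_absNorm_le (S := 𝓞 F) B
  let gen : Ideal (𝓞 F) → 𝓞 F := fun I =>
    if h : ∃ η, η ≠ 0 ∧ P η ∧ Ideal.span {η} = I then h.choose else 1
  have hgen : ∀ η, η ≠ 0 → P η → P (gen (Ideal.span {η})) ∧
      Ideal.span {gen (Ideal.span {η})} = Ideal.span {η} := by
    intro η h0 hP
    have h : ∃ η', η' ≠ 0 ∧ P η' ∧ Ideal.span {η'} = Ideal.span {η} := ⟨η, h0, hP, rfl⟩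
    simp only [gen, dif_pos h]
    exact h.choose_spec.2
  have hgen0 : ∀ I, gen I ≠ 0 := by
    intro I
    by_cases h : ∃ η, η ≠ 0 ∧ P η ∧ Ideal.span {η} = I
    · simp only [gen, dif_pos h]
      exact h.choose_spec.1
    · simp only [gen, dif_neg h]
      exact one_ne_zero
  refine ⟨hfin.toFinset.image gen, ?_, ?_⟩
  · intro η hη
    obtain ⟨I, -, rfl⟩ := Finset.mem_image.mp hη
    exact hgen0 I
  · intro κ hκ α hα hα0 ⟨x, hx, hmin⟩
    obtain ⟨γ, rfl⟩ := Ideal.mem_span_singleton'.mp hα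
    have hγ0 : γ ≠ 0 := left_ne_zero_of_mul hα0
    have hκF : (κ : F) ≠ 0 := RingOfIntegers.coe_ne_zero_iff.mpr hκ
    have hPγ : P γ := by
      refine ⟨fun j => x j * σ j (nm κ), fun j => mul_pos (hx j) (hpos j _ hκF), ?_⟩
      intro β hβ
      have h := hmin (β * κ) (mul_ne_zero hβ hκ) (Ideal.mem_span_singleton'.mpr ⟨β, rfl⟩)
      have h2 : ∀ δ : 𝓞 F, weightedNorm σ nm x ((δ * κ : 𝓞 F) : F) =
          weightedNorm σ nm (fun j => x j * σ j (nm κ)) (δ : F) := by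
        intro δ
        unfold weightedNorm
        refine Finset.sum_congr rfl fun j _ => ?_
        have h3 : ((δ * κ : 𝓞 F) : F) = (δ : F) * (κ : F) := rfl
        rw [h3, hmul, map_mul]
        ring
      rwa [h2, h2] at h
    obtain ⟨hP, hspan⟩ := hgen γ hγ0 hPγ
    have hmem : Ideal.absNorm (Ideal.span {γ}) ≤ B := by
      obtain ⟨y, hy, hy2⟩ := hPγ
      refine hB (fun w => y (J w)) (fun w => hy _) γ fun β hβ => ?_
      rw [← hwn, ← hwn]
      exact hy2 β hβ
    obtain ⟨u, hu⟩ := Ideal.span_singleton_eq_span_singleton.mp hspan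
    refine ⟨u, gen (Ideal.span {γ}), Finset.mem_image_of_mem _ (by simpa using hmem), ?_, hP⟩
    rw [mul_assoc, mul_comm (u : 𝓞 F), hu, mul_comm]
end

section
/- Let F be a CM number field with maximal totally real subfield K of degree k over ℚ, and let M = {Σ(β) : β ∈ O_F, β ≠ 0} ⊆ ℝ^k. A nonzero element α ∈ O_F has minimal weighted norm over O_F for some choice of positive weights x_1, …, x_k if and only if Σ(α) lies on the boundary (frontier) of the convex hull of M. -/
open NumberField Finset

lemma aux_support {n : ℕ} (M : Set (Fin n → ℝ)) (p : Fin n → ℝ) (hp : p ∈ M)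
    (hi : p ∉ interior (convexHull ℝ M)) :
    ∃ f : (Fin n → ℝ) →ₗ[ℝ] ℝ, f ≠ 0 ∧ ∀ y ∈ M, f p ≤ f y := by
  by_cases hne : (interior (convexHull ℝ M)).Nonempty
  · have hc : Convex ℝ (convexHull ℝ M) := convex_convexHull ℝ M
    obtain ⟨f, hf⟩ := geometric_hahn_banach_point_open hc.interior isOpen_interior hi
    refine ⟨f.toLinearMap, ?_, ?_⟩
    · intro h0
      obtain ⟨y, hy⟩ := hne
      have h1 := hf y hy
      have h2 : ∀ z, f z = 0 := fun z => by
        have := congrArg (fun g => g z) h0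
        simpa using this
      rw [h2, h2] at h1
      exact lt_irrefl _ h1
    · intro y hy
      have hcl : y ∈ closure (interior (convexHull ℝ M)) := by
        rw [hc.closure_interior_eq_closure_of_nonempty_interior hne]
        exact subset_closure (subset_convexHull ℝ M hy)
      have hsub : closure (interior (convexHull ℝ M)) ⊆ {z | f p ≤ f z} :=
        closure_minimal (fun z hz => (hf z hz).le)
          (isClosed_le continuous_const f.continuous)
      exact hsub hcl
  · rw [interior_convexHull_nonempty_iff_affineSpan_eq_top] at hne
    have hpS : p ∈ affineSpan ℝ M := subset_affineSpan ℝ M hp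
    rw [← AffineSubspace.direction_eq_top_iff_of_nonempty ⟨p, hpS⟩] at hne
    obtain ⟨f, hf0, hf⟩ := Submodule.exists_le_ker_of_lt_top _ (lt_top_iff_ne_top.2 hne)
    refine ⟨f, hf0, fun y hy => ?_⟩
    have h1 := hf (AffineSubspace.vsub_mem_direction (subset_affineSpan ℝ M hy) hpS)
    simp only [vsub_eq_sub, LinearMap.mem_ker, map_sub] at h1
    linarith

lemma aux_not_interior {n : ℕ} (M : Set (Fin n → ℝ)) (p : Fin n → ℝ)
    (f : (Fin n → ℝ) →ₗ[ℝ] ℝ) (hf0 : f ≠ 0) (hf : ∀ y ∈ M, f p ≤ f y) :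
    p ∉ interior (convexHull ℝ M) := by
  intro hi
  have hsub : convexHull ℝ M ⊆ {z | f p ≤ f z} :=
    convexHull_min hf (convex_halfSpace_ge f.isLinear _)
  obtain ⟨v, hv⟩ : ∃ v, f v ≠ 0 := by
    by_contra! h
    exact hf0 (LinearMap.ext h)
  have hcont : Filter.Tendsto (fun t : ℝ => p - t • (f v • v)) (nhds 0) (nhds p) := by
    have : Continuous (fun t : ℝ => p - t • (f v • v)) := by fun_prop
    simpa using this.tendsto 0
  have hev := hcont.eventually (isOpen_interior.mem_nhds hi)
  obtain ⟨ε, hε, h⟩ := Metric.eventually_nhds_iff.1 hev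
  have h2 := hsub (interior_subset (h (y := ε / 2) (by
    rw [Real.dist_eq, sub_zero, abs_of_pos (by positivity)]; linarith)))
  simp only [Set.mem_ofPred_eq, map_sub, map_smul, smul_eq_mul] at h2
  have : 0 < ε / 2 * (f v * f v) := by
    have := mul_self_pos.2 hv
    positivity
  linarith

lemma aux_pos {F K : Type*} [Field F] [Field K] [NumberField F] [NumberField K] [Algebra K F]
    (hTI : IsEmpty (F →+* ℝ)) (hquad : Module.finrank K F = 2)
    (conj : F ≃ₐ[K] F) (hconj : conj ≠ AlgEquiv.refl) (s : K →+* ℝ)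
    (nm : F → K) (hnm : ∀ α : F, algebraMap K F (nm α) = α * conj α)
    (α : F) (hα : α ≠ 0) : 0 < s (nm α) := by
  have : Algebra.IsQuadraticExtension K F := ⟨hquad⟩
  have hG : IsGalois K F := inferInstance
  have hcard := IsGalois.card_aut_eq_finrank K F
  rw [hquad] at hcard
  set φ₀ : K →+* ℂ := Complex.ofRealHom.comp s with hφ₀
  set φ := ComplexEmbedding.lift F φ₀ with hφ
  have hl : φ.comp (algebraMap K F) = φ₀ := ComplexEmbedding.lift_comp_algebraMap F φ₀
  have hla : ∀ a, φ (algebraMap K F a) = (s a : ℂ) := fun a => RingHom.congr_fun hl a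
  obtain ⟨τ, hτ⟩ := ComplexEmbedding.exists_comp_symm_eq_of_comp_eq (k := K) φ
    (ComplexEmbedding.conjugate φ) (by
      ext a
      simp [ComplexEmbedding.conjugate_coe_eq, hla])
  have hτ1 : τ ≠ AlgEquiv.refl := by
    rintro rfl
    have hr : ComplexEmbedding.IsReal φ := by
      rw [ComplexEmbedding.isReal_iff, ← hτ]
      ext a
      rfl
    exact hTI.false hr.embedding
  have hτc : τ = conj := by
    by_contra hne
    have : Finite Gal(F/K) := inferInstance
    have := Fintype.ofFinite Gal(F/K)
    rw [Nat.card_eq_fintype_card] at hcard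
    have h3 : ({τ, conj, AlgEquiv.refl} : Set Gal(F/K)).ncard = 3 :=
      Set.ncard_eq_three.2 ⟨τ, conj, AlgEquiv.refl, hne, hτ1, hconj, rfl⟩
    have h4 := Set.ncard_le_card ({τ, conj, AlgEquiv.refl} : Set Gal(F/K))
    rw [Nat.card_eq_fintype_card] at h4
    omega
  have h5 : φ α = star (φ (conj α)) := by
    have := RingHom.congr_fun hτ (conj α)
    rw [hτc] at this
    simpa [ComplexEmbedding.conjugate_coe_eq] using this
  have h6 : ((s (nm α) : ℝ) : ℂ) = ((Complex.normSq (φ (conj α)) : ℝ) : ℂ) := by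
    rw [← hla, hnm, map_mul, h5, Complex.normSq_eq_conj_mul_self]
    rfl
  rw [Complex.ofReal_inj.1 h6]
  apply Complex.normSq_pos.2
  simpa using hα

lemma aux_unit {K : Type*} [Field K] [NumberField K] {n : ℕ}
    (σ : Fin n → (K →+* ℝ)) (hσ : Function.Injective σ) (j : Fin n) :
    ∃ u : (𝓞 K)ˣ, 1 ≤ |σ j (u : K)| ∧ ∀ i, i ≠ j → |σ i (u : K)| < 1 := by
  classical
  set w : Fin n → InfinitePlace K := fun i =>
    InfinitePlace.mk (Complex.ofRealHom.comp (σ i)) with hw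
  have hwa : ∀ i a, w i a = |σ i a| := fun i a => by
    simp [hw, InfinitePlace.apply]
  have hinj : ∀ i, i ≠ j → w i ≠ w j := by
    intro i hij h
    apply hij
    apply hσ
    ext a
    rcases InfinitePlace.mk_eq_iff.1 h with h | h
    · have := RingHom.congr_fun h a
      simpa using this
    · have := RingHom.congr_fun h a
      simpa [ComplexEmbedding.conjugate_coe_eq] using this
  obtain ⟨u, hu⟩ := Units.dirichletUnitTheorem.exists_unit K (w j)
  have hpos : ∀ v : InfinitePlace K, 0 < v (u : K) := fun v =>
    InfinitePlace.pos_iff.2 (Units.coe_ne_zero u)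
  refine ⟨u, ?_, ?_⟩
  · have hsum := Units.sum_mult_mul_log u
    rw [← Finset.add_sum_erase _ _ (Finset.mem_univ (w j))] at hsum
    have hle : ∑ v ∈ Finset.univ.erase (w j), (v.mult : ℝ) * Real.log (v (u : K)) ≤ 0 :=
      Finset.sum_nonpos fun v hv =>
        mul_nonpos_of_nonneg_of_nonpos (by positivity) (hu v (Finset.ne_of_mem_erase hv)).le
    have hm : (0 : ℝ) < (w j).mult := by exact_mod_cast InfinitePlace.mult_pos
    have h0 : 0 ≤ Real.log (w j (u : K)) := by
      by_contra! h
      nlinarith [mul_neg_of_pos_of_neg hm h]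
    rw [← hwa]
    exact (Real.log_nonneg_iff (hpos _)).1 h0
  · intro i hi
    rw [← hwa]
    exact (Real.log_neg_iff (hpos _)).1 (hu _ (hinj i hi))

lemma aux_weights {n : ℕ} (x t p : Fin n → ℝ) (j : Fin n) (hx0 : x ≠ 0) (hp : ∀ i, 0 < p i)
    (htj : 1 ≤ t j) (ht0 : ∀ i, 0 ≤ t i) (ht : ∀ i, i ≠ j → t i < 1)
    (hj : x j < 0 ∨ (x j = 0 ∧ ∀ i, 0 ≤ x i))
    (H : ∀ N l : ℕ, ∑ i, x i * p i ≤ ∑ i, x i * (((N : ℝ) + 1) ^ 2 * t i ^ l)) : False := by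
  set T : ℕ → ℝ := fun l => ∑ i ∈ Finset.univ.erase j, x i * t i ^ l with hT
  have hlim : Filter.Tendsto T Filter.atTop (nhds 0) := by
    have : Filter.Tendsto T Filter.atTop
        (nhds (∑ i ∈ Finset.univ.erase j, x i * 0)) :=
      tendsto_finsetSum _ fun i hi =>
        (tendsto_pow_atTop_nhds_zero_of_lt_one (ht0 i)
          (ht i (Finset.ne_of_mem_erase hi))).const_mul (x i)
    simpa using this
  have hsplit : ∀ N l : ℕ, ∑ i, x i * (((N : ℝ) + 1) ^ 2 * t i ^ l)
      = ((N : ℝ) + 1) ^ 2 * (x j * t j ^ l + T l) := by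
    intro N l
    rw [hT, Finset.add_sum_erase _ (fun i => x i * t i ^ l) (Finset.mem_univ j),
      Finset.mul_sum]
    exact Finset.sum_congr rfl fun i _ => by ring
  rcases hj with hj | ⟨hj, hx⟩
  · obtain ⟨l, hl⟩ := (hlim.eventually (gt_mem_nhds (neg_pos.2 hj))).exists
    have h1 : 1 ≤ t j ^ l := one_le_pow₀ htj
    set S := x j * t j ^ l + T l with hS
    have hSneg : S < 0 := by nlinarith
    set c := ∑ i, x i * p i
    obtain ⟨N, hN⟩ := exists_nat_gt (c / S)
    have h2 := H N l
    rw [hsplit] at h2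
    rw [div_lt_iff_of_neg hSneg] at hN
    have hN0 : (0 : ℝ) ≤ N := Nat.cast_nonneg N
    nlinarith [mul_nonneg hN0 hN0]
  · have hc : 0 < ∑ i, x i * p i := by
      obtain ⟨i, hi⟩ := Function.ne_iff.1 hx0
      apply Finset.sum_pos' (fun i _ => mul_nonneg (hx i) (hp i).le)
      exact ⟨i, Finset.mem_univ i, mul_pos (lt_of_le_of_ne (hx i) (Ne.symm hi)) (hp i)⟩
    obtain ⟨l, hl⟩ := (hlim.eventually (gt_mem_nhds hc)).exists
    have h2 := H 0 l
    rw [hsplit, hj] at h2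
    norm_num at h2
    linarith

theorem minimal_iff_on_frontier_of_convexHull
    {F K : Type*} [Field F] [Field K] [NumberField F] [NumberField K] [Algebra K F]
    -- `K` is totally real
    (hTR : ∀ τ : K →+* ℂ, ∀ x : K, (τ x).im = 0)
    -- `F` is totally imaginary
    (hTI : IsEmpty (F →+* ℝ))
    -- `F/K` is quadratic, so `F` is a CM field with maximal totally real subfield `K`
    (hquad : Module.finrank K F = 2)
    -- complex conjugation: the nontrivial element of `Gal(F/K)`
    (conj : F ≃ₐ[K] F) (hconj : conj ≠ AlgEquiv.refl)
    -- `k = m + 1` is the degree of `K` over `ℚ`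
    (m : ℕ) (hk : Module.finrank ℚ K = m + 1)
    -- the `k` real embeddings of `K`
    (σ : Fin (m + 1) → (K →+* ℝ)) (hσ : Function.Bijective σ)
    -- the relative norm `α ↦ α·conj α`, valued in `K`
    (nm : F → K) (hnm : ∀ α : F, algebraMap K F (nm α) = α * conj α)
    -- `M = Σ(𝓞_F ∖ {0})`
    (M : Set (Fin (m + 1) → ℝ))
    (hM : M = {p | ∃ β : 𝓞 F, β ≠ 0 ∧ p = SigmaMap σ nm (β : F)})
    (α : 𝓞 F) (hα : α ≠ 0) :
    (∃ x : Fin (m + 1) → ℝ, (∀ j, 0 < x j) ∧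
      ∀ β : 𝓞 F, β ≠ 0 → weightedNorm σ nm x (α : F) ≤ weightedNorm σ nm x (β : F)) ↔
      SigmaMap σ nm (α : F) ∈ frontier (convexHull ℝ M) := by
  have hinjA : Function.Injective (algebraMap K F) := (algebraMap K F).injective
  have hnmK : ∀ a : K, nm (algebraMap K F a) = a ^ 2 := fun a => by
    apply hinjA
    rw [hnm, conj.commutes, map_pow, sq]
  have hp : SigmaMap σ nm (α : F) ∈ M := by
    rw [hM]
    exact ⟨α, hα, rfl⟩
  constructor
  · rintro ⟨x, hx, hmin⟩
    refine ⟨subset_closure (subset_convexHull ℝ M hp), ?_⟩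
    refine aux_not_interior M _ (∑ i, x i • LinearMap.proj i) ?_ ?_
    · intro h0
      have := congrArg (fun g => g (fun _ => (1 : ℝ))) h0
      simp at this
      have h1 : 0 < ∑ i, x i := Finset.sum_pos (fun i _ => hx i) Finset.univ_nonempty
      linarith
    · intro y hy
      rw [hM] at hy
      obtain ⟨β, hβ, rfl⟩ := hy
      have := hmin β hβ
      simpa [weightedNorm, SigmaMap] using this
  · intro hfr
    obtain ⟨f, hf0, hf⟩ := aux_support M _ hp hfr.2
    set x : Fin (m + 1) → ℝ := fun i => f (Pi.single i 1) with hx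
    have hfx : ∀ y, f y = ∑ i, x i * y i := by
      intro y
      rw [LinearMap.pi_apply_eq_sum_univ f y]
      refine Finset.sum_congr rfl fun i _ => ?_
      rw [smul_eq_mul, mul_comm, hx]
      congr 2
      ext l
      simp [Pi.single_apply, eq_comm]
    have hx0 : x ≠ 0 := by
      intro h
      apply hf0
      ext y
      simp [hfx, h]
    have hmin : ∀ β : 𝓞 F, β ≠ 0 →
        weightedNorm σ nm x (α : F) ≤ weightedNorm σ nm x (β : F) := by
      intro β hβ
      have := hf (SigmaMap σ nm (β : F)) (by rw [hM]; exact ⟨β, hβ, rfl⟩)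
      rw [hfx, hfx] at this
      exact this
    have hαF : (α : F) ≠ 0 := by simpa using hα
    have hpos : ∀ i, 0 < σ i (nm (α : F)) := fun i =>
      aux_pos hTI hquad conj hconj (σ i) nm hnm α hαF
    refine ⟨x, ?_, hmin⟩
    by_contra! hcon
    have key : ∃ j, x j < 0 ∨ (x j = 0 ∧ ∀ i, 0 ≤ x i) := by
      by_cases h : ∃ j, x j < 0
      · obtain ⟨j, hj⟩ := h
        exact ⟨j, Or.inl hj⟩
      · push Not at h
        obtain ⟨j, hj⟩ := hcon
        exact ⟨j, Or.inr ⟨le_antisymm hj (h j), h⟩⟩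
    obtain ⟨j, hj⟩ := key
    obtain ⟨u, hu1, hu2⟩ := aux_unit σ hσ.1 j
    refine aux_weights x (fun i => (σ i (u : K)) ^ 2) (fun i => σ i (nm (α : F))) j hx0 hpos
      ?_ (fun i => sq_nonneg _) ?_ hj ?_
    · exact (one_le_sq_iff_one_le_abs _).2 hu1
    · intro i hi
      exact (sq_lt_one_iff_abs_lt_one _).2 (hu2 i hi)
    · intro N l
      set b : 𝓞 K := ((N : 𝓞 K) + 1) * (u : 𝓞 K) ^ l with hb
      have hbK : (b : K) = ((N : K) + 1) * (u : K) ^ l := by simp [hb]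
      have hb0 : (b : K) ≠ 0 := by
        rw [hbK]
        exact mul_ne_zero (Nat.cast_add_one_ne_zero N) (pow_ne_zero _ (Units.coe_ne_zero u))
      have hbF : ((algebraMap (𝓞 K) (𝓞 F) b : 𝓞 F) : F) = algebraMap K F (b : K) := rfl
      have h := hmin (algebraMap (𝓞 K) (𝓞 F) b) (by
        intro h0
        apply hb0
        apply hinjA
        rw [← hbF, h0]
        simp)
      unfold weightedNorm at h
      rw [hbF, hnmK, hbK] at h
      refine h.trans (le_of_eq (Finset.sum_congr rfl fun i _ => ?_))
      simp only [map_pow, map_mul, map_add, map_natCast, map_one]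
      ring
end

section
/- Let F be a CM number field with maximal totally real subfield K of degree k over ℚ, and fix units g_1, …, g_{k−1} of O_F whose classes generate O_F^× modulo torsion. If α ∈ O_F is a nonzero element minimal over O_F for some choice of positive weights, then N_ℚ(α) ≤ max_s max{Π_{j=1}^k p_j : p ∈ Σ(Δ_s)}, where the outer maximum is over all permutations s of {1,…,k−1} and the inner maximum is of the coordinate product over the simplex Σ(Δ_s). -/
open NumberField Finset

namespace KuhnAux
variable {ι : Type*} [DecidableEq ι]

def W (h : ι → (ι → ℤ) → ZMod 2) : List ι → Finset ι → (ι → ℤ) → ZMod 2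
  | [], _, _ => 1
  | j :: l, S, c => ∑ i ∈ S, (h j (c + Pi.single i 1) + h j c) * W h l (S.erase i) (c + Pi.single i 1)

lemma z2 (a : ZMod 2) : a + a = 0 := CharTwo.add_self_eq_zero a

lemma sum_symm (S : Finset ι) (f : ι → ι → ZMod 2) (hf : ∀ i j, f i j = f j i) :
    ∑ i ∈ S, ∑ j ∈ S.erase i, f i j = 0 := by
  rw [Finset.sum_sigma']
  refine Finset.sum_involution (fun x _ => ⟨x.2, x.1⟩) ?_ ?_ ?_ ?_
  · rintro ⟨i, j⟩ _
    simp only [hf j i]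
    exact z2 _
  · rintro ⟨i, j⟩ hij _ h
    simp only [Finset.mem_sigma, Finset.mem_erase] at hij
    simp only [Sigma.mk.injEq] at h
    exact hij.2.1 h.1
  · rintro ⟨i, j⟩ hij
    simp only [Finset.mem_sigma, Finset.mem_erase] at hij ⊢
    exact ⟨hij.2.2, hij.2.1.symm, hij.1⟩
  · rintro ⟨i, j⟩ _
    rfl

lemma sum_swap (S : Finset ι) (f : ι → ι → ZMod 2) :
    ∑ i ∈ S, ∑ j ∈ S.erase i, f i j = ∑ i ∈ S, ∑ j ∈ S.erase i, f j i := by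
  refine Finset.sum_comm' ?_
  intro x y
  simp only [Finset.mem_erase]
  tauto

lemma closed (h : ι → (ι → ℤ) → ZMod 2) (l : List ι) : ∀ (S : Finset ι) (c : ι → ℤ),
    ∑ i ∈ S, (W h l (S.erase i) (c + Pi.single i 1) + W h l (S.erase i) c) = 0 := by
  induction l with
  | nil => intro S c; simp [W, z2]
  | cons k l ih =>
    intro S c
    set e : ι → ι → ℤ := fun i => Pi.single i 1 with he
    have key : ∀ i ∈ S, W h (k :: l) (S.erase i) (c + e i) + W h (k :: l) (S.erase i) c =
      ∑ j ∈ S.erase i, h k (c + e i + e j) * W h l ((S.erase i).erase j) (c + e i + e j)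
      + ∑ j ∈ S.erase i, h k (c + e i) * W h l ((S.erase i).erase j) (c + e i + e j)
      + ∑ j ∈ S.erase i, h k (c + e j) * W h l ((S.erase i).erase j) (c + e j)
      + ∑ j ∈ S.erase i, h k c * W h l ((S.erase i).erase j) (c + e j) := by
      intro i _
      simp only [W, ← Finset.sum_add_distrib]
      refine Finset.sum_congr rfl fun j _ => ?_
      simp only [he]; ring
    rw [Finset.sum_congr rfl key]
    simp only [Finset.sum_add_distrib]
    have s1 := sum_symm S (fun i j => h k (c + e i + e j) * W h l ((S.erase i).erase j) (c + e i + e j))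
      (by intro i j; rw [Finset.erase_right_comm, add_right_comm])
    have s1' := sum_symm S (fun i j => h k c * W h l ((S.erase i).erase j) (c + e i + e j))
      (by intro i j; rw [Finset.erase_right_comm, add_right_comm])
    have s2 := sum_swap S (fun i j => h k (c + e j) * W h l ((S.erase i).erase j) (c + e j))
    have s4 := sum_swap S (fun i j => h k c * W h l ((S.erase i).erase j) (c + e j))
    have her : ∀ i j, (S.erase j).erase i = (S.erase i).erase j := fun i j => Finset.erase_right_comm
    simp only [her] at s1 s1' s2 s4 ⊢
    try rw [s1, s2, s4]
    have h3 : ∑ i ∈ S, ∑ j ∈ S.erase i, h k (c + e i) * W h l ((S.erase i).erase j) (c + e i + e j)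
      + ∑ i ∈ S, ∑ j ∈ S.erase i, h k (c + e i) * W h l ((S.erase i).erase j) (c + e i) = 0 := by
      rw [← Finset.sum_add_distrib]
      refine Finset.sum_eq_zero fun i _ => ?_
      have := ih (S.erase i) (c + e i)
      rw [← Finset.sum_add_distrib]
      simp only [← mul_add, ← Finset.mul_sum]
      rw [this, mul_zero]
    have h4 : ∑ i ∈ S, ∑ j ∈ S.erase i, h k c * W h l ((S.erase i).erase j) (c + e i + e j)
      + ∑ i ∈ S, ∑ j ∈ S.erase i, h k c * W h l ((S.erase i).erase j) (c + e i) = 0 := by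
      rw [← Finset.sum_add_distrib]
      refine Finset.sum_eq_zero fun i _ => ?_
      have := ih (S.erase i) (c + e i)
      rw [← Finset.sum_add_distrib]
      simp only [← mul_add, ← Finset.mul_sum]
      rw [this, mul_zero]
    rw [s1', zero_add] at h4
    rw [zero_add, h3, zero_add]
    exact h4

lemma W_cons (h : ι → (ι → ℤ) → ZMod 2) (k : ι) (l : List ι) (S : Finset ι) (c : ι → ℤ) :
    W h (k :: l) S c = ∑ i ∈ S, (h k (c + Pi.single i 1) * W h l (S.erase i) (c + Pi.single i 1)
      + h k c * W h l (S.erase i) c) := by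
  have := closed h l S c
  have h2 : h k c * ∑ i ∈ S, (W h l (S.erase i) (c + Pi.single i 1) + W h l (S.erase i) c) = 0 := by
    rw [this, mul_zero]
  rw [← add_zero (W h (k :: l) S c), ← h2, W, Finset.mul_sum, ← Finset.sum_add_distrib]
  refine Finset.sum_congr rfl fun i _ => ?_
  linear_combination z2 (h k c * W h l (S.erase i) (c + Pi.single i 1))

variable [Fintype ι]

noncomputable def box (p : ℕ) (S : Finset ι) (b : ι → ℤ) : Finset (ι → ℤ) :=
  Fintype.piFinset fun i => if i ∈ S then Finset.Ico (0 : ℤ) p else {b i}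

lemma mem_box {p : ℕ} {S : Finset ι} {b c : ι → ℤ} :
    c ∈ box p S b ↔ (∀ i ∈ S, 0 ≤ c i ∧ c i < p) ∧ ∀ i, i ∉ S → c i = b i := by
  simp only [box, Fintype.mem_piFinset]
  constructor
  · intro h
    refine ⟨fun i hi => by simpa [hi] using h i, fun i hi => by simpa [hi] using h i⟩
  · rintro ⟨h1, h2⟩ i
    by_cases hi : i ∈ S
    · simpa [hi] using h1 i hi
    · simpa [hi] using h2 i hi

lemma box_split (p : ℕ) (S : Finset ι) (b : ι → ℤ) (i : ι) (hi : i ∈ S) (f : (ι → ℤ) → ZMod 2) :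
    ∑ c ∈ box p S b, f c =
      ∑ k ∈ Finset.range p, ∑ c ∈ box p (S.erase i) (Function.update b i k), f c := by
  rw [Finset.sum_sigma']
  symm
  refine Finset.sum_bij' (fun x _ => x.2) (fun c _ => ⟨(c i).toNat, c⟩) ?_ ?_ ?_ ?_ ?_
  · rintro ⟨k, c⟩ hc
    simp only [Finset.mem_sigma, mem_box, Finset.mem_range, Finset.mem_erase] at hc ⊢
    obtain ⟨hk, h1, h2⟩ := hc
    have hci : c i = k := by simpa using h2 i (by simp)
    refine ⟨fun j hj => ?_, fun j hj => ?_⟩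
    · by_cases hji : j = i
      · subst hji; rw [hci]; omega
      · exact h1 j ⟨hji, hj⟩
    · have hji : j ≠ i := fun h => hj (h ▸ hi)
      simpa [hji] using h2 j (by tauto)
  · intro c hc
    simp only [Finset.mem_sigma, mem_box, Finset.mem_range, Finset.mem_erase] at hc ⊢
    have := hc.1 i hi
    refine ⟨by omega, fun j hj => hc.1 j hj.2, fun j hj => ?_⟩
    by_cases hji : j = i
    · subst hji; simp; omega
    · simpa [hji] using hc.2 j (by tauto)
  · rintro ⟨k, c⟩ hc
    simp only [Finset.mem_sigma, mem_box] at hc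
    have hci : c i = k := by simpa using hc.2.2 i (by simp)
    simp [hci]
  · intro c hc; rfl
  · rintro ⟨k, c⟩ hc; rfl

lemma box_shift (p : ℕ) (S : Finset ι) (b : ι → ℤ) (i : ι) (hi : i ∉ S) (k : ℤ)
    (f : (ι → ℤ) → ZMod 2) :
    ∑ c ∈ box p S (Function.update b i k), f (c + Pi.single i 1) =
      ∑ c ∈ box p S (Function.update b i (k + 1)), f c := by
  refine Finset.sum_bij' (fun c _ => c + Pi.single i 1) (fun c _ => c - Pi.single i 1) ?_ ?_ ?_ ?_ ?_
  · intro c hc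
    simp only [mem_box] at hc ⊢
    refine ⟨fun j hj => ?_, fun j hj => ?_⟩
    · have hji : j ≠ i := fun h => hi (h ▸ hj)
      simpa [hji] using hc.1 j hj
    · have := hc.2 j hj
      by_cases hji : j = i
      · subst hji; simpa using this
      · simpa [hji] using this
  · intro c hc
    simp only [mem_box] at hc ⊢
    refine ⟨fun j hj => ?_, fun j hj => ?_⟩
    · have hji : j ≠ i := fun h => hi (h ▸ hj)
      simpa [hji] using hc.1 j hj
    · have := hc.2 j hj
      by_cases hji : j = i
      · subst hji; simp at this ⊢; omega
      · simpa [hji] using this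
  · intro c _; simp
  · intro c _; simp
  · intro c _; rfl

lemma box_diff (p : ℕ) (S : Finset ι) (b : ι → ℤ) (i : ι) (hi : i ∈ S) (f : (ι → ℤ) → ZMod 2) :
    ∑ c ∈ box p S b, (f (c + Pi.single i 1) + f c) =
      ∑ c ∈ box p (S.erase i) (Function.update b i p), f c
      + ∑ c ∈ box p (S.erase i) (Function.update b i 0), f c := by
  rw [box_split p S b i hi]
  simp only [Finset.sum_add_distrib, box_shift p (S.erase i) b i (by simp)]
  rw [← Finset.sum_add_distrib]
  set A : ℕ → ZMod 2 := fun k => ∑ c ∈ box p (S.erase i) (Function.update b i (k : ℤ)), f c with hA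
  have : ∀ q : ℕ, ∑ k ∈ Finset.range q, (A (k + 1) + A k) = A q + A 0 := by
    intro q
    induction q with
    | zero => simp [z2]
    | succ q ih => rw [Finset.sum_range_succ, ih]; linear_combination z2 (A q)
  have h2 := this p
  simpa [hA] using h2

lemma W_zero (h : ι → (ι → ℤ) → ZMod 2) (i : ι) (a : ℤ)
    (hc : ∃ v, ∀ x : ι → ℤ, x i = a → h i x = v) (l : List ι) :
    ∀ (S : Finset ι) (c : ι → ℤ), i ∈ l → i ∉ S → c i = a → W h l S c = 0 := by
  induction l with
  | nil => intro S c hl; simp at hl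
  | cons k l ih =>
    intro S c hl hS hca
    rw [W]
    refine Finset.sum_eq_zero fun j hj => ?_
    have hji : i ≠ j := fun h => hS (h ▸ hj)
    have hca' : (c + Pi.single j 1 : ι → ℤ) i = a := by simp [hji, hca]
    rcases List.mem_cons.1 hl with rfl | hl
    · obtain ⟨v, hv⟩ := hc
      rw [hv _ hca', hv _ hca, z2, zero_mul]
    · rw [ih _ _ hl (by simp [hS]) hca', mul_zero]

theorem count (p : ℕ) (h : ι → (ι → ℤ) → ZMod 2) (h0 : ∀ i (x : ι → ℤ), x i = 0 → h i x = 0)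
    (h1 : ∀ i (x : ι → ℤ), x i = (p : ℤ) → h i x = 1) (l : List ι) : l.Nodup → ∀ b : ι → ℤ,
    ∑ c ∈ box p l.toFinset b, W h l l.toFinset c = 1 := by
  induction l with
  | nil =>
    intro _ b
    have : box p (∅ : Finset ι) b = {b} := by
      ext c; simp [mem_box, funext_iff]
    simp [W, this]
  | cons k l ih =>
    intro hn b
    have hk : k ∉ l := (List.nodup_cons.1 hn).1
    set S := (k :: l).toFinset with hS
    have hkS : k ∈ S := by simp [hS]
    have hSk : S.erase k = l.toFinset := by
      simp [hS, hk]
    simp only [W_cons]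
    rw [Finset.sum_comm]
    rw [Finset.sum_eq_single_of_mem k hkS]
    · rw [box_diff p S b k hkS (fun c => h k c * W h l (S.erase k) c)]
      rw [hSk]
      have e1 : ∑ c ∈ box p l.toFinset (Function.update b k p), h k c * W h l l.toFinset c = 1 := by
        rw [← ih (List.nodup_cons.1 hn).2 (Function.update b k p)]
        refine Finset.sum_congr rfl fun c hc => ?_
        have := (mem_box.1 hc).2 k (by simpa using hk)
        rw [h1 k c (by simpa using this), one_mul]
      have e2 : ∑ c ∈ box p l.toFinset (Function.update b k 0), h k c * W h l l.toFinset c = 0 := by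
        refine Finset.sum_eq_zero fun c hc => ?_
        have := (mem_box.1 hc).2 k (by simpa using hk)
        rw [h0 k c (by simpa using this), zero_mul]
      rw [e1, e2, add_zero]
    · intro i hi hik
      rw [box_diff p S b i hi (fun c => h k c * W h l (S.erase i) c)]
      have hil : i ∈ l := by simpa [hS, hik] using hi
      rw [Finset.sum_eq_zero, Finset.sum_eq_zero, add_zero]
      · intro c hc
        have := (mem_box.1 hc).2 i (by simp)
        rw [W_zero h i 0 ⟨0, h0 i⟩ l _ c hil (by simp) (by simpa using this), mul_zero]
      · intro c hc
        have := (mem_box.1 hc).2 i (by simp)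
        rw [W_zero h i p ⟨1, h1 i⟩ l _ c hil (by simp) (by simpa using this), mul_zero]

lemma W_ne (h : ι → (ι → ℤ) → ZMod 2) (l : List ι) :
    ∀ (S : Finset ι) (c : ι → ℤ), W h l S c ≠ 0 → ∀ j ∈ l, ∃ x y : ι → ℤ, h j x ≠ h j y ∧
      (∀ i, c i ≤ x i ∧ x i ≤ c i + if i ∈ S then 1 else 0) ∧
      (∀ i, c i ≤ y i ∧ y i ≤ c i + if i ∈ S then 1 else 0) := by
  induction l with
  | nil => intro S c _ j hj; simp at hj
  | cons k l ih =>
    intro S c hW j hj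
    rw [W] at hW
    obtain ⟨i, hi, hne⟩ := Finset.exists_ne_zero_of_sum_ne_zero hW
    have ha := left_ne_zero_of_mul hne
    have hb := right_ne_zero_of_mul hne
    rcases List.mem_cons.1 hj with rfl | hj
    · refine ⟨c + Pi.single i 1, c, fun h => ha (by rw [h, z2]), fun t => ?_, fun t => ?_⟩
      · by_cases hti : t = i
        · subst hti; simp [hi]
        · simp [hti]; split_ifs <;> simp
      · split_ifs <;> simp
    · obtain ⟨x, y, hxy, hx, hy⟩ := ih _ _ hb j hj
      have aux : ∀ x : ι → ℤ, (∀ t, (c + Pi.single i 1 : ι → ℤ) t ≤ x t ∧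
          x t ≤ (c + Pi.single i 1 : ι → ℤ) t + if t ∈ S.erase i then 1 else 0) →
          ∀ t, c t ≤ x t ∧ x t ≤ c t + if t ∈ S then 1 else 0 := by
        intro x hx t
        have := hx t
        by_cases hti : t = i
        · subst hti; simp at this; simp [hi]; omega
        · simpa [hti] using this
      exact ⟨x, y, hxy, aux x hx, aux y hy⟩

theorem kuhn (p : ℕ) (h : ι → (ι → ℤ) → ZMod 2) (h0 : ∀ i (x : ι → ℤ), x i = 0 → h i x = 0)
    (h1 : ∀ i (x : ι → ℤ), x i = (p : ℤ) → h i x = 1) :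
    ∃ c : ι → ℤ, (∀ i, 0 ≤ c i ∧ c i < p) ∧ ∀ j, ∃ x y : ι → ℤ, h j x = 0 ∧ h j y = 1 ∧
      (∀ i, c i ≤ x i ∧ x i ≤ c i + 1) ∧ (∀ i, c i ≤ y i ∧ y i ≤ c i + 1) := by
  have hc := count p h h0 h1 (Finset.univ : Finset ι).toList (Finset.nodup_toList _) 0
  rw [Finset.toList_toFinset] at hc
  obtain ⟨c, hcb, hne⟩ := Finset.exists_ne_zero_of_sum_ne_zero (by rw [hc]; exact one_ne_zero)
  refine ⟨c, fun i => (mem_box.1 hcb).1 i (Finset.mem_univ _), fun j => ?_⟩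
  obtain ⟨x, y, hxy, hx, hy⟩ := W_ne h _ _ c hne j (by simp)
  simp only [Finset.mem_univ, if_true] at hx hy
  have h01 : ∀ a b : ZMod 2, a ≠ b → (a = 0 ∧ b = 1) ∨ (b = 0 ∧ a = 1) := by decide
  rcases h01 _ _ hxy with h | h
  · exact ⟨x, y, h.1, h.2, hx, hy⟩
  · exact ⟨y, x, h.1, h.2, hy, hx⟩

end KuhnAux

namespace KuhnAux
open Filter Topology MeasureTheory
variable {ι : Type*} [DecidableEq ι] [Fintype ι]

theorem exists_zero (G : (ι → ℝ) → (ι → ℝ)) (hG : Continuous G) (C : ℝ)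
    (hC : ∀ a i, |G a i - a i| ≤ C) : ∃ a, G a = 0 := by
  obtain ⟨R, hR⟩ := exists_nat_gt C
  have step : ∀ N : ℕ, ∃ a ∈ Set.Icc (fun _ : ι => -(R : ℝ)) (fun _ => (R : ℝ)), ∀ j,
      ∃ x y : ι → ℝ, dist x a ≤ 1 / ((N : ℝ) + 1) ∧ dist y a ≤ 1 / ((N : ℝ) + 1) ∧
        G x j ≤ 0 ∧ 0 < G y j := by
    intro N
    have hN : (0 : ℝ) < (N : ℝ) + 1 := by positivity
    set pt : (ι → ℤ) → ι → ℝ := fun z i => -(R : ℝ) + z i / ((N : ℝ) + 1) with hpt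
    obtain ⟨c, hc, hj⟩ := kuhn (2 * R * (N + 1)) (fun i z => if 0 < G (pt z) i then 1 else 0)
      (by
        intro i z hz
        have h1 := hC (pt z) i
        have h2 : pt z i = -(R : ℝ) := by simp [hpt, hz]
        rw [h2, abs_le] at h1
        rw [if_neg]
        linarith [h1.2])
      (by
        intro i z hz
        have h1 := hC (pt z) i
        have h2 : pt z i = (R : ℝ) := by
          simp only [hpt, hz]; push_cast; field_simp; ring
        rw [h2, abs_le] at h1
        rw [if_pos]
        linarith [h1.1])
    have hd : ∀ x : ι → ℤ, (∀ i, c i ≤ x i ∧ x i ≤ c i + 1) →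
        dist (pt x) (pt c) ≤ 1 / ((N : ℝ) + 1) := by
      intro x hx
      rw [dist_pi_le_iff (by positivity)]
      intro i
      have h1 : (c i : ℝ) ≤ x i := by exact_mod_cast (hx i).1
      have h2 : (x i : ℝ) ≤ c i + 1 := by exact_mod_cast (hx i).2
      rw [Real.dist_eq, show pt x i - pt c i = ((x i : ℝ) - c i) / ((N : ℝ) + 1) by
        simp only [hpt]; ring, abs_of_nonneg (div_nonneg (by linarith) hN.le)]
      gcongr
      linarith
    refine ⟨pt c, ⟨fun i => ?_, fun i => ?_⟩, fun j => ?_⟩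
    · have h1 : (0 : ℝ) ≤ c i := by exact_mod_cast (hc i).1
      have : 0 ≤ (c i : ℝ) / ((N : ℝ) + 1) := div_nonneg h1 hN.le
      simp only [hpt]; linarith
    · have h1 : (c i : ℝ) ≤ 2 * R * ((N : ℝ) + 1) := by exact_mod_cast (hc i).2.le
      have : (c i : ℝ) / ((N : ℝ) + 1) ≤ 2 * R := by
        rw [div_le_iff₀ hN]; exact h1
      simp only [hpt]; linarith
    · obtain ⟨x, y, hx, hy, hx', hy'⟩ := hj j
      refine ⟨pt x, pt y, hd x hx', hd y hy', ?_, ?_⟩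
      · by_contra hcon
        rw [if_pos (not_le.1 hcon)] at hx
        exact one_ne_zero hx
      · by_contra hcon
        rw [if_neg hcon] at hy
        exact zero_ne_one hy
  choose a ha x y hx hy hGx hGy using step
  obtain ⟨z, -, φ, hφ, hz⟩ := isCompact_Icc.tendsto_subseq ha
  have hlim0 : Tendsto (fun n => 1 / ((φ n : ℝ) + 1)) atTop (𝓝 0) :=
    tendsto_one_div_add_atTop_nhds_zero_nat.comp hφ.tendsto_atTop
  refine ⟨z, funext fun j => ?_⟩
  have conv : ∀ w : ℕ → ι → ℝ, (∀ n, dist (w n) (a n) ≤ 1 / ((n : ℝ) + 1)) →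
      Tendsto (fun n => G (w (φ n)) j) atTop (𝓝 (G z j)) := by
    intro w hw
    have h1 : Tendsto (fun n => w (φ n)) atTop (𝓝 z) := by
      rw [tendsto_iff_dist_tendsto_zero] at hz ⊢
      refine squeeze_zero (fun _ => dist_nonneg) (g := fun n => 1 / ((φ n : ℝ) + 1) + dist (a (φ n)) z)
        (fun n => (dist_triangle _ (a (φ n)) _).trans (by gcongr; exact hw _)) ?_
      simpa using hlim0.add hz
    exact ((continuous_apply j).comp hG).continuousAt.tendsto.comp h1
  apply le_antisymm
  · exact le_of_tendsto' (conv (fun n => x n j) (fun n => hx n j)) fun n => hGx _ _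
  · exact ge_of_tendsto' (conv (fun n => y n j) (fun n => hy n j)) fun n => (hGy _ _).le

section interp
variable {m : ℕ} (L : Fin m → Fin (m + 1) → ℝ)

noncomputable def E (z : Fin m → ℤ) (j : Fin (m + 1)) : ℝ := Real.exp (∑ i, z i * L i j)

noncomputable def fl (a : Fin m → ℝ) (θ : ℝ) : Fin m → ℤ := fun i => ⌊a i + θ⌋

noncomputable def ff (a : Fin m → ℝ) (j : Fin (m + 1)) : ℝ := ∫ θ in (0 : ℝ)..1, E L (fl a θ) j

lemma E_pos (z : Fin m → ℤ) (j : Fin (m + 1)) : 0 < E L z j := Real.exp_pos _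

lemma E_bound (a : Fin m → ℝ) (θ : ℝ) (h0 : 0 ≤ θ) (h1 : θ ≤ 1) (j : Fin (m + 1)) :
    Real.exp (∑ i, a i * L i j - ∑ i, |L i j|) ≤ E L (fl a θ) j ∧
    E L (fl a θ) j ≤ Real.exp (∑ i, a i * L i j + ∑ i, |L i j|) := by
  have key : |∑ i, (fl a θ i : ℝ) * L i j - ∑ i, a i * L i j| ≤ ∑ i, |L i j| := by
    rw [← Finset.sum_sub_distrib]
    refine (Finset.abs_sum_le_sum_abs _ _).trans (Finset.sum_le_sum fun i _ => ?_)
    rw [← sub_mul, abs_mul]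
    have : |(fl a θ i : ℝ) - a i| ≤ 1 := by
      have e1 := Int.floor_le (a i + θ)
      have e2 := Int.lt_floor_add_one (a i + θ)
      rw [abs_le]; simp only [fl]; constructor <;> linarith
    calc _ ≤ 1 * |L i j| := by gcongr
      _ = _ := one_mul _
  rw [abs_le] at key
  simp only [E, Real.exp_le_exp]
  constructor <;> linarith [key.1, key.2]

lemma E_meas (a : Fin m → ℝ) (j : Fin (m + 1)) : Measurable fun θ => E L (fl a θ) j := by
  unfold E fl
  refine Real.measurable_exp.comp (Finset.measurable_sum _ fun i _ => ?_)
  refine Measurable.mul_const ?_ _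
  have h1 : Measurable fun θ : ℝ => ⌊a i + θ⌋ := Int.measurable_floor.comp (measurable_const_add _)
  exact (measurable_of_countable (fun n : ℤ => (n : ℝ))).comp h1

lemma E_int (a : Fin m → ℝ) (j : Fin (m + 1)) :
    IntegrableOn (fun θ => E L (fl a θ) j) (Set.Ioc 0 1) := by
  refine Measure.integrableOn_of_bounded (M := Real.exp (∑ i, a i * L i j + ∑ i, |L i j|)) (by simp)
    (E_meas L a j).aestronglyMeasurable ?_
  refine (ae_restrict_iff' measurableSet_Ioc).2 (Eventually.of_forall fun θ hθ => ?_)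
  rw [Real.norm_eq_abs, abs_of_pos (E_pos L _ _)]
  exact (E_bound L a θ hθ.1.le hθ.2 j).2

lemma ff_bound (a : Fin m → ℝ) (j : Fin (m + 1)) :
    Real.exp (∑ i, a i * L i j - ∑ i, |L i j|) ≤ ff L a j ∧
    ff L a j ≤ Real.exp (∑ i, a i * L i j + ∑ i, |L i j|) := by
  have hi : IntervalIntegrable (fun θ => E L (fl a θ) j) volume 0 1 :=
    (intervalIntegrable_iff_integrableOn_Ioc_of_le zero_le_one).2 (E_int L a j)
  constructor
  · have := intervalIntegral.integral_mono_on (μ := volume) zero_le_one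
      (intervalIntegrable_const (c := Real.exp (∑ i, a i * L i j - ∑ i, |L i j|))) hi
      (fun θ hθ => (E_bound L a θ hθ.1 hθ.2 j).1)
    simpa [ff] using this
  · have := intervalIntegral.integral_mono_on (μ := volume) zero_le_one hi
      (intervalIntegrable_const (c := Real.exp (∑ i, a i * L i j + ∑ i, |L i j|)))
      (fun θ hθ => (E_bound L a θ hθ.1 hθ.2 j).2)
    simpa [ff] using this

lemma ff_pos (a : Fin m → ℝ) (j : Fin (m + 1)) : 0 < ff L a j :=
  (Real.exp_pos _).trans_le (ff_bound L a j).1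

lemma floor_ev (y : ℝ) (hy : ∀ n : ℤ, y ≠ n) : ∀ᶠ x in 𝓝 y, ⌊x⌋ = ⌊y⌋ := by
  have h1 : (⌊y⌋ : ℝ) < y := lt_of_le_of_ne (Int.floor_le y) (fun h => hy _ h.symm)
  filter_upwards [Ioo_mem_nhds h1 (Int.lt_floor_add_one y)] with x hx
  rw [Int.floor_eq_iff]
  exact ⟨hx.1.le, hx.2⟩

lemma ff_cont (j : Fin (m + 1)) : Continuous fun a => ff L a j := by
  rw [continuous_iff_continuousAt]
  intro a0
  have hc : Continuous fun a : Fin m → ℝ => Real.exp (∑ i, a i * L i j + ∑ i, |L i j|) := by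
    fun_prop
  refine intervalIntegral.continuousAt_of_dominated_interval
    (bound := fun _ => Real.exp (∑ i, a0 i * L i j + ∑ i, |L i j|) + 1) ?_ ?_ ?_ ?_
  · exact Eventually.of_forall fun a => (E_meas L a j).aestronglyMeasurable
  · filter_upwards [hc.continuousAt.eventually_lt_const (lt_add_one _)] with a ha
    refine Eventually.of_forall fun θ hθ => ?_
    rw [Set.uIoc_of_le zero_le_one] at hθ
    rw [Real.norm_eq_abs, abs_of_pos (E_pos L _ _)]
    exact (E_bound L a θ hθ.1.le hθ.2 j).2.trans ha.le
  · exact intervalIntegrable_const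
  · have hcount : (⋃ i, Set.range fun n : ℤ => (n : ℝ) - a0 i).Countable :=
      Set.countable_iUnion fun i => Set.countable_range _
    have := hcount.ae_notMem volume
    filter_upwards [this] with θ hθ _
    have h1 : ∀ i, ∀ᶠ a in 𝓝 a0, fl a θ i = fl a0 θ i := by
      intro i
      have hy : ∀ n : ℤ, a0 i + θ ≠ n := by
        intro n hn
        apply hθ
        simp only [Set.mem_iUnion, Set.mem_range]
        exact ⟨i, n, by linarith⟩
      have hcc : Continuous fun a : Fin m → ℝ => a i + θ := by fun_prop
      exact hcc.continuousAt.eventually (floor_ev _ hy)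
    have h2 : ∀ᶠ a in 𝓝 a0, E L (fl a θ) j = E L (fl a0 θ) j := by
      filter_upwards [eventually_all.2 h1] with a ha
      rw [funext ha]
    exact (continuousAt_const (y := E L (fl a0 θ) j)).congr (h2.mono fun _ h => h.symm)

lemma lower_fin (p : Fin m → Prop) (hp : ∀ l l', l ≤ l' → p l' → p l) :
    ∃ r : Fin (m + 1), ∀ l : Fin m, p l ↔ (l : ℕ) < r := by
  classical
  have hex : ∃ n : ℕ, ∀ l : Fin m, p l → (l : ℕ) < n := ⟨m, fun l _ => l.2⟩
  have hle : Nat.find hex ≤ m := Nat.find_min' hex fun l _ => l.2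
  refine ⟨⟨Nat.find hex, by omega⟩, fun l => ⟨Nat.find_spec hex l, fun hl => ?_⟩⟩
  by_contra hpl
  refine Nat.find_min hex hl fun l' hl' => ?_
  by_contra h
  exact hpl (hp l l' (by rw [Fin.le_def]; omega) hl')

lemma simplex (a : Fin m → ℝ) : ∃ s : Equiv.Perm (Fin m), ∀ θ : ℝ, 0 ≤ θ → θ ≤ 1 →
    ∃ r : Fin (m + 1), ∀ j, E L (fl a θ) j = E L (fl a 0) j *
      ∏ l ∈ Finset.univ.filter (fun l : Fin m => (l : ℕ) < (r : ℕ)), Real.exp (L (s l) j) := by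
  refine ⟨Tuple.sort fun i => -Int.fract (a i), fun θ h0 h1 => ?_⟩
  set s := Tuple.sort fun i => -Int.fract (a i) with hs
  have hmono : Monotone ((fun i => -Int.fract (a i)) ∘ s) := Tuple.monotone_sort _
  obtain ⟨r, hr⟩ := lower_fin (fun l => 1 ≤ Int.fract (a (s l)) + θ) (by
    intro l l' hll hl'
    have := hmono hll
    simp only [Function.comp] at this
    linarith)
  refine ⟨r, fun j => ?_⟩
  have hfl : ∀ l, (fl a θ (s l) : ℝ) = fl a 0 (s l) + if (l : ℕ) < r then 1 else 0 := by
    intro l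
    have e0 := Int.fract_nonneg (a (s l))
    have e1 := Int.fract_lt_one (a (s l))
    have e2 := Int.floor_add_fract (a (s l))
    have : fl a θ (s l) = fl a 0 (s l) + if (l : ℕ) < r then 1 else 0 := by
      simp only [fl, add_zero]
      rw [Int.floor_eq_iff]
      by_cases hl : (l : ℕ) < r
      · have := (hr l).2 hl
        simp only [hl, if_true]; push_cast
        constructor <;> linarith
      · have := not_le.1 fun h => hl ((hr l).1 h)
        simp only [hl, if_false]; push_cast
        constructor <;> linarith
    rw [this]; push_cast; rfl
  rw [← Real.exp_sum, E, E, ← Real.exp_add]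
  congr 1
  rw [← Equiv.sum_comp s, ← Equiv.sum_comp s (fun i => (fl a 0 i : ℝ) * L i j), Finset.sum_filter,
    ← Finset.sum_add_distrib]
  refine Finset.sum_congr rfl fun l _ => ?_
  rw [hfl]; split_ifs <;> ring

lemma ff_mem (a : Fin m → ℝ) : ∃ s : Equiv.Perm (Fin m),
    (fun j => ff L a j / E L (fl a 0) j) ∈ convexHull ℝ (Set.range fun r : Fin (m + 1) => fun j =>
      ∏ l ∈ Finset.univ.filter (fun l : Fin m => (l : ℕ) < (r : ℕ)), Real.exp (L (s l) j)) := by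
  obtain ⟨s, hs⟩ := simplex L a
  refine ⟨s, ?_⟩
  set V := Set.range fun r : Fin (m + 1) => fun j =>
      ∏ l ∈ Finset.univ.filter (fun l : Fin m => (l : ℕ) < (r : ℕ)), Real.exp (L (s l) j) with hV
  have hprob : IsProbabilityMeasure (volume.restrict (Set.Ioc (0 : ℝ) 1)) := ⟨by simp⟩
  have hint : ∀ j, Integrable (fun θ => E L (fl a θ) j / E L (fl a 0) j)
      (volume.restrict (Set.Ioc (0 : ℝ) 1)) := fun j => (E_int L a j).div_const _
  have hm := Convex.integral_mem (μ := volume.restrict (Set.Ioc (0 : ℝ) 1)) (s := convexHull ℝ V)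
    (f := fun θ j => E L (fl a θ) j / E L (fl a 0) j) (convex_convexHull ℝ V)
    ((Set.finite_range _).isCompact_convexHull (𝕜 := ℝ)).isClosed ?_ (Integrable.of_eval hint)
  · convert hm using 1
    funext j
    rw [eval_integral hint, integral_div, ff, intervalIntegral.integral_of_le zero_le_one]
  · refine (ae_restrict_iff' measurableSet_Ioc).2 (Eventually.of_forall fun θ hθ => ?_)
    obtain ⟨r, hr⟩ := hs θ hθ.1.le hθ.2
    apply subset_convexHull
    refine ⟨r, funext fun j => ?_⟩
    rw [hr j, mul_div_cancel_left₀]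
    exact (Real.exp_pos _).ne'

theorem ray (hL : IsUnit (Matrix.of fun j i : Fin m => L i j.succ - L i 0))
    (P : Fin (m + 1) → ℝ) (hP : ∀ j, 0 < P j) :
    ∃ (z : Fin m → ℤ) (s : Equiv.Perm (Fin m)) (q : Fin (m + 1) → ℝ) (t : ℝ), 0 < t ∧
      q ∈ convexHull ℝ (Set.range fun r : Fin (m + 1) => fun j =>
        ∏ l ∈ Finset.univ.filter (fun l : Fin m => (l : ℕ) < (r : ℕ)), Real.exp (L (s l) j)) ∧
      ∀ j, E L z j * q j = t * P j := by
  set M := Matrix.of fun j i : Fin m => L i j.succ - L i 0 with hM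
  have hMd : IsUnit M.det := (Matrix.isUnit_iff_isUnit_det M).1 hL
  set Ψ : (Fin m → ℝ) → Fin m → ℝ := fun a j =>
    Real.log (ff L a j.succ) - Real.log (ff L a 0) - (Real.log (P j.succ) - Real.log (P 0)) with hΨ
  have hlc : ∀ j, Continuous fun a => Real.log (ff L a j) := fun j =>
    (ff_cont L j).log fun a => (ff_pos L a j).ne'
  have hΨc : Continuous Ψ := continuous_pi fun j => ((hlc _).sub (hlc _)).sub continuous_const
  have hlog : ∀ a j, |Real.log (ff L a j) - ∑ i, a i * L i j| ≤ ∑ i, |L i j| := by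
    intro a j
    have h := ff_bound L a j
    have h1 := (Real.le_log_iff_exp_le (ff_pos L a j)).2 h.1
    have h2 := (Real.log_le_iff_le_exp (ff_pos L a j)).2 h.2
    rw [abs_le]; constructor <;> linarith
  set D : Fin m → ℝ := fun j => ∑ i, |L i j.succ| + ∑ i, |L i 0| + |Real.log (P j.succ) - Real.log (P 0)|
  have hΨb : ∀ a j, |Ψ a j - (M.mulVec a) j| ≤ D j := by
    intro a j
    have e : (M.mulVec a) j = ∑ i, a i * L i j.succ - ∑ i, a i * L i 0 := by
      simp only [Matrix.mulVec, dotProduct, hM, Matrix.of_apply, ← Finset.sum_sub_distrib]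
      exact Finset.sum_congr rfl fun i _ => by ring
    have h1 := hlog a j.succ
    have h2 := hlog a 0
    have h3 := le_abs_self (Real.log (P j.succ) - Real.log (P 0))
    have h4 := neg_abs_le (Real.log (P j.succ) - Real.log (P 0))
    rw [abs_le] at h1 h2 ⊢
    simp only [hΨ, e, D]
    constructor <;> linarith [h1.1, h1.2, h2.1, h2.2]
  have hGc : Continuous fun a => M⁻¹.mulVec (Ψ a) := by
    exact Continuous.matrix_mulVec continuous_const hΨc
  obtain ⟨a, ha⟩ := exists_zero (fun a => M⁻¹.mulVec (Ψ a)) hGc (∑ i, ∑ j, |M⁻¹ i j| * D j) (by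
    intro a i
    have e1 : M⁻¹.mulVec (M.mulVec a) = a := by
      rw [Matrix.mulVec_mulVec, Matrix.nonsing_inv_mul _ hMd, Matrix.one_mulVec]
    have e2 : M⁻¹.mulVec (Ψ a) i - a i = ∑ j, M⁻¹ i j * (Ψ a j - (M.mulVec a) j) := by
      conv_lhs => rw [← congrFun e1 i]
      rw [← Pi.sub_apply, ← Matrix.mulVec_sub]
      rfl
    rw [e2]
    calc _ ≤ ∑ j, |M⁻¹ i j * (Ψ a j - (M.mulVec a) j)| := Finset.abs_sum_le_sum_abs _ _
      _ ≤ ∑ j, |M⁻¹ i j| * D j := Finset.sum_le_sum fun j _ => by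
          rw [abs_mul]; gcongr; exact hΨb a j
      _ ≤ _ := Finset.single_le_sum (f := fun i => ∑ j, |M⁻¹ i j| * D j)
          (fun i _ => Finset.sum_nonneg fun j _ => mul_nonneg (abs_nonneg _)
            (by simp only [D]; positivity)) (Finset.mem_univ i))
  have hΨ0 : Ψ a = 0 := by
    have : M.mulVec (M⁻¹.mulVec (Ψ a)) = Ψ a := by
      rw [Matrix.mulVec_mulVec, Matrix.mul_nonsing_inv _ hMd, Matrix.one_mulVec]
    rw [← this]
    rw [ha, Matrix.mulVec_zero]
  obtain ⟨s, hs⟩ := ff_mem L a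
  refine ⟨fl a 0, s, _, ff L a 0 / P 0, div_pos (ff_pos L a 0) (hP 0), hs, fun j => ?_⟩
  rw [mul_div_cancel₀ _ (E_pos L _ _).ne']
  refine Fin.cases ?_ (fun j => ?_) j
  · rw [div_mul_cancel₀ _ (hP 0).ne']
  · have h := congrFun hΨ0 j
    simp only [hΨ, Pi.zero_apply] at h
    have hpos := ff_pos L a j.succ
    have hpos0 := ff_pos L a 0
    apply Real.log_injOn_pos (Set.mem_Ioi.2 hpos)
      (Set.mem_Ioi.2 (mul_pos (div_pos hpos0 (hP 0)) (hP _)))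
    rw [Real.log_mul (div_pos hpos0 (hP 0)).ne' (hP _).ne', Real.log_div hpos0.ne' (hP 0).ne']
    linarith

end interp
end KuhnAux

namespace KuhnAux
section NT
variable {F K : Type*} [Field F] [Field K] [NumberField F] [NumberField K] [Algebra K F]

lemma emb_norm (hTR : ∀ τ : K →+* ℂ, ∀ x : K, (τ x).im = 0)
    (hTI : IsEmpty (F →+* ℝ)) (hquad : Module.finrank K F = 2)
    (conj : F ≃ₐ[K] F) (m : ℕ)
    (σ : Fin (m + 1) → (K →+* ℝ)) (hσ : Function.Bijective σ)
    (nm : F → K) (hnm : ∀ α : F, algebraMap K F (nm α) = α * conj α) (τ : F →+* ℂ) :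
    ∃ j, (∀ x : K, τ (algebraMap K F x) = σ j x) ∧ ∀ α : F, ‖τ α‖ ^ 2 = σ j (nm α) := by
  have hreal : ComplexEmbedding.IsReal (τ.comp (algebraMap K F)) := by
    rw [ComplexEmbedding.isReal_iff]
    ext x
    rw [ComplexEmbedding.conjugate_coe_eq]
    exact Complex.conj_eq_iff_im.2 (hTR (τ.comp (algebraMap K F)) x)
  obtain ⟨j, hj⟩ := hσ.2 hreal.embedding
  have hjx : ∀ x : K, τ (algebraMap K F x) = σ j x := by
    intro x
    rw [hj, ComplexEmbedding.IsReal.coe_embedding_apply]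
    rfl
  refine ⟨j, hjx, ?_⟩
  have hnr : ¬ ComplexEmbedding.IsReal τ := fun h => hTI.false h.embedding
  obtain ⟨α0, hα0⟩ : ∃ α0 : F, (starRingEnd ℂ) (τ α0) ≠ τ α0 := by
    by_contra hcon
    push Not at hcon
    apply hnr
    rw [ComplexEmbedding.isReal_iff]
    ext x
    rw [ComplexEmbedding.conjugate_coe_eq]
    exact hcon x
  have hstar : ∀ x : K, (starRingEnd ℂ) (τ (algebraMap K F x)) = τ (algebraMap K F x) := by
    intro x; rw [hjx, Complex.conj_ofReal]
  have hT : algebraMap K F (nm (α0 + 1) - nm α0 - 1) = α0 + conj α0 := by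
    simp only [map_sub, map_one, hnm, map_add]; ring
  set T := nm (α0 + 1) - nm α0 - 1
  have h1 : τ (conj α0) = (starRingEnd ℂ) (τ α0) := by
    have e1 : τ α0 * τ α0 - τ (algebraMap K F T) * τ α0 + τ (algebraMap K F (nm α0)) = 0 := by
      rw [hT, hnm]; simp only [map_add, map_mul]; ring
    have e2 := congrArg (starRingEnd ℂ) e1
    simp only [map_add, map_sub, map_mul, hstar, map_zero] at e2
    have e3 : ((starRingEnd ℂ) (τ α0) - τ α0) *
        ((starRingEnd ℂ) (τ α0) + τ α0 - τ (algebraMap K F T)) = 0 := by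
      linear_combination e2 - e1
    have e4 := (mul_eq_zero.1 e3).resolve_left (sub_ne_zero.2 hα0)
    rw [hT, map_add] at e4
    linear_combination -e4
  have hli : LinearIndependent K ![(1 : F), α0] := by
    rw [LinearIndependent.pair_iff]
    intro a b hab
    by_cases hb : b = 0
    · subst hb
      simp at hab
      exact ⟨hab, rfl⟩
    · exfalso
      apply hα0
      have : α0 = algebraMap K F (-a / b) := by
        have hb' : algebraMap K F b ≠ 0 := by simpa using hb
        rw [map_div₀, map_neg, eq_div_iff hb']
        simp only [Algebra.smul_def, mul_one] at hab
        linear_combination hab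
      rw [this]
      exact hstar _
  have hspan := hli.span_eq_top_of_card_eq_finrank' (by simp [hquad])
  have hconj : ∀ β : F, τ (conj β) = (starRingEnd ℂ) (τ β) := by
    intro β
    have hβ : β ∈ Submodule.span K (Set.range ![(1 : F), α0]) := by rw [hspan]; trivial
    simp only [Matrix.range_cons, Matrix.range_empty, Set.union_empty, Set.singleton_union] at hβ
    obtain ⟨a, b, rfl⟩ := Submodule.mem_span_pair.1 hβ
    simp only [Algebra.smul_def, mul_one, map_add, map_mul, AlgEquiv.commutes, h1, hstar]
  intro α
  have e : ((‖τ α‖ ^ 2 : ℝ) : ℂ) = σ j (nm α) := by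
    rw [← hjx, hnm, map_mul, hconj, Complex.mul_conj, Complex.normSq_eq_norm_sq]
  exact_mod_cast e

lemma places (hTR : ∀ τ : K →+* ℂ, ∀ x : K, (τ x).im = 0)
    (hTI : IsEmpty (F →+* ℝ)) (hquad : Module.finrank K F = 2)
    (conj : F ≃ₐ[K] F) (m : ℕ)
    (σ : Fin (m + 1) → (K →+* ℝ)) (hσ : Function.Bijective σ)
    (nm : F → K) (hnm : ∀ α : F, algebraMap K F (nm α) = α * conj α) :
    ∃ w : Fin (m + 1) ≃ InfinitePlace F, (∀ j, (w j).mult = 2) ∧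
      ∀ j (α : F), σ j (nm α) = (w j α) ^ 2 := by
  have key := emb_norm hTR hTI hquad conj m σ hσ nm hnm
  have hex : ∀ j, ∃ w : InfinitePlace F, ∀ α : F, σ j (nm α) = (w α) ^ 2 := by
    intro j
    let _ : Algebra K ℂ := (Complex.ofRealHom.comp (σ j)).toAlgebra
    have : FiniteDimensional K F := Module.finite_of_finrank_pos (by omega)
    have : Algebra.IsAlgebraic K F := Algebra.IsAlgebraic.of_finite K F
    let τ : F →ₐ[K] ℂ := IsAlgClosed.lift
    obtain ⟨j', h1, h2⟩ := key τ.toRingHom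
    have hjj : j' = j := by
      apply hσ.1
      ext x
      have e1 := h1 x
      have e2 : τ.toRingHom (algebraMap K F x) = ((σ j x : ℝ) : ℂ) := τ.commutes x
      rw [e2] at e1
      exact_mod_cast e1.symm
    subst hjj
    refine ⟨InfinitePlace.mk τ.toRingHom, fun α => ?_⟩
    rw [InfinitePlace.apply, h2]
  choose w hw using hex
  have hinj : Function.Injective w := by
    intro j j' hjj
    apply hσ.1
    ext x
    have hnmx : ∀ y : K, nm (algebraMap K F y) = y ^ 2 := by
      intro y
      apply (algebraMap K F).injective
      rw [hnm, AlgEquiv.commutes, map_pow, sq]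
    have hq : ∀ y : K, (σ j y) ^ 2 = (σ j' y) ^ 2 := by
      intro y
      rw [← map_pow, ← map_pow, ← hnmx, hw, hw, hjj]
    have a1 := hq x
    have a2 := hq (x + 1)
    simp only [map_add, map_one] at a2
    linarith
  have hsurj : Function.Surjective w := by
    intro v
    obtain ⟨j, -, hj⟩ := key v.embedding
    refine ⟨j, ?_⟩
    apply DFunLike.ext
    intro α
    have e1 : (w j α) ^ 2 = (v α) ^ 2 := by
      rw [← hw, ← hj, InfinitePlace.norm_embedding_eq]
    exact (sq_eq_sq₀ (apply_nonneg _ _) (apply_nonneg _ _)).1 e1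
  refine ⟨Equiv.ofBijective w ⟨hinj, hsurj⟩, fun j => ?_, hw⟩
  rw [InfinitePlace.mult, if_neg]
  intro h
  exact hTI.false (InfinitePlace.embedding_of_isReal h)

open NumberField.Units NumberField.Units.dirichletUnitTheorem in
lemma indep (m : ℕ) (w : Fin (m + 1) ≃ InfinitePlace F) (hmult : ∀ j, (w j).mult = 2)
    (g : Fin m → (𝓞 F)ˣ)
    (hgen : ∀ u : (𝓞 F)ˣ, ∃ t ∈ NumberField.Units.torsion F, ∃ a : Fin m → ℤ,
      u = t * ∏ i, g i ^ a i)
    (ℓ : Fin (m + 1) → (𝓞 F)ˣ →* Multiplicative ℝ)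
    (hℓ : ∀ j u, (ℓ j u).toAdd = 2 * Real.log (w j (u : F))) :
    IsUnit (Matrix.of fun j i : Fin m => (ℓ j.succ (g i)).toAdd - (ℓ 0 (g i)).toAdd) := by
  classical
  rw [Matrix.isUnit_iff_isUnit_det, isUnit_iff_ne_zero]
  intro hdet
  obtain ⟨c, hc0, hc⟩ := Matrix.exists_vecMul_eq_zero_iff.2 hdet
  have hsum : ∀ u, ∑ j, (ℓ j u).toAdd = 0 := by
    intro u
    rw [← sum_mult_mul_log u, ← Equiv.sum_comp w]
    refine Finset.sum_congr rfl fun j _ => ?_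
    rw [hℓ, hmult]; rfl
  set C : Fin (m + 1) → ℝ := Fin.cons (-∑ j, c j) c with hC
  have hCs : ∑ j, C j = 0 := by
    rw [Fin.sum_univ_succ]; simp [hC]
  have hg : ∀ i, ∑ j, C j * (ℓ j (g i)).toAdd = 0 := by
    intro i
    have := congrFun hc i
    simp only [Matrix.vecMul, dotProduct, Matrix.of_apply, Pi.zero_apply, mul_sub,
      Finset.sum_sub_distrib, ← Finset.sum_mul] at this
    rw [Fin.sum_univ_succ]
    simp only [hC, Fin.cons_zero, Fin.cons_succ]
    linarith
  have hu : ∀ u, ∑ j, C j * (ℓ j u).toAdd = 0 := by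
    intro u
    obtain ⟨t, ht, a, rfl⟩ := hgen u
    have ht' : ∀ j, (ℓ j t).toAdd = 0 := by
      intro j
      rw [hℓ, (mem_torsion F).1 ht (w j)]; simp
    have e : ∀ j, (ℓ j (t * ∏ i, g i ^ a i)).toAdd = ∑ i, (a i : ℝ) * (ℓ j (g i)).toAdd := by
      intro j
      rw [map_mul, toAdd_mul, ht', zero_add, map_prod, toAdd_prod]
      refine Finset.sum_congr rfl fun i _ => ?_
      rw [map_zpow, toAdd_zpow, zsmul_eq_mul]
    simp only [e, Finset.mul_sum]
    rw [Finset.sum_comm]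
    refine Finset.sum_eq_zero fun i _ => ?_
    have := hg i
    calc _ = (a i : ℝ) * ∑ j, C j * (ℓ j (g i)).toAdd := by
          rw [Finset.mul_sum]; exact Finset.sum_congr rfl fun j _ => by ring
      _ = 0 := by rw [this, mul_zero]
  set k0 := C (w.symm w₀) with hk0
  let Φ : logSpace F →ₗ[ℝ] ℝ :=
    ∑ v : {v : InfinitePlace F // v ≠ w₀}, (C (w.symm v.1) - k0) • LinearMap.proj v
  have hΦ : ∀ y, Φ y = ∑ v : {v : InfinitePlace F // v ≠ w₀}, (C (w.symm v.1) - k0) * y v := by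
    intro y; simp [Φ]
  have hker : Submodule.span ℝ (unitLattice F : Set (logSpace F)) ≤ LinearMap.ker Φ := by
    rw [Submodule.span_le]
    rintro y ⟨u, -, rfl⟩
    change Φ _ = 0
    rw [hΦ]
    have e0 := Fintype.sum_eq_add_sum_subtype_ne (fun v : InfinitePlace F =>
      (C (w.symm v) - k0) * ((v.mult : ℝ) * Real.log (v ((Additive.toMul u : (𝓞 F)ˣ) : F)))) w₀
    rw [← hk0, sub_self, zero_mul, zero_add] at e0
    refine Eq.trans ?_ (e0.symm.trans ?_)
    · rfl
    · rw [← Equiv.sum_comp w]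
      have e1 := hu (Additive.toMul u)
      have e2 := hsum (Additive.toMul u)
      simp only [Equiv.symm_apply_apply, hmult, sub_mul, Finset.sum_sub_distrib]
      simp only [hℓ] at e1 e2
      push_cast
      rw [e1, ← Finset.mul_sum, e2]; simp
  rw [unitLattice_span_eq_top] at hker
  have hconst : ∀ j, C j = k0 := by
    intro j
    by_cases hj : w j = w₀
    · rw [hk0, ← hj, Equiv.symm_apply_apply]
    · have : Φ (Pi.single ⟨w j, hj⟩ 1) = 0 := hker (Submodule.mem_top)
      rw [hΦ] at this
      simp [Pi.single_apply] at this
      linarith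
  have hk : k0 = 0 := by
    simp only [hconst, Finset.sum_const, Finset.card_univ, Fintype.card_fin, nsmul_eq_mul] at hCs
    rcases mul_eq_zero.1 hCs with h | h
    · exact absurd h (Nat.cast_ne_zero.2 (Nat.succ_ne_zero m))
    · exact h
  apply hc0
  funext j
  have := hconst j.succ
  simp only [hC, Fin.cons_succ] at this
  rw [this, hk]; rfl

end NT

lemma amgm {n : ℕ} (y : Fin n → ℝ) (hy : ∀ j, 0 ≤ y j) (hs : ∑ j, y j = n) : ∏ j, y j ≤ 1 := by
  calc ∏ j, y j ≤ ∏ j, Real.exp (y j - 1) :=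
        Finset.prod_le_prod (fun j _ => hy j) fun j _ => by linarith [Real.add_one_le_exp (y j - 1)]
    _ = 1 := by rw [← Real.exp_sum, Finset.sum_sub_distrib, hs]; simp

end KuhnAux

theorem norm_bound_max_over_fundamental_simplices
    {F K : Type*} [Field F] [Field K] [NumberField F] [NumberField K] [Algebra K F]
    -- `K` is totally real
    (hTR : ∀ τ : K →+* ℂ, ∀ x : K, (τ x).im = 0)
    -- `F` is totally imaginary
    (hTI : IsEmpty (F →+* ℝ))
    -- `F/K` is quadratic, so `F` is a CM field with maximal totally real subfield `K`
    (hquad : Module.finrank K F = 2)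
    -- complex conjugation: the nontrivial element of `Gal(F/K)`
    (conj : F ≃ₐ[K] F) (hconj : conj ≠ AlgEquiv.refl)
    -- `k = m + 1` is the degree of `K` over `ℚ`
    (m : ℕ) (hk : Module.finrank ℚ K = m + 1)
    -- the `k` real embeddings of `K`
    (σ : Fin (m + 1) → (K →+* ℝ)) (hσ : Function.Bijective σ)
    -- the relative norm `α ↦ α·conj α`, valued in `K`
    (nm : F → K) (hnm : ∀ α : F, algebraMap K F (nm α) = α * conj α)
    -- units generating `𝓞_F^×` modulo torsion
    (g : Fin m → (𝓞 F)ˣ)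
    (hgen : ∀ u : (𝓞 F)ˣ, ∃ t ∈ NumberField.Units.torsion F, ∃ a : Fin m → ℤ,
      u = t * ∏ i, g i ^ a i)
    -- `α` is a nonzero element minimal for some choice of positive weights
    (α : 𝓞 F) (hα : α ≠ 0)
    (hmin : ∃ x : Fin (m + 1) → ℝ, (∀ j, 0 < x j) ∧
      ∀ β : 𝓞 F, β ≠ 0 → weightedNorm σ nm x (α : F) ≤ weightedNorm σ nm x (β : F)) :
    fieldNormQ σ nm (α : F) ≤
      Finset.univ.sup' Finset.univ_nonempty fun s : Equiv.Perm (Fin m) =>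
        sSup ((fun p => ∏ j, p j) ''
          convexHull ℝ (Set.range (simplexVertex σ nm g s))) := by

  obtain ⟨w, hmult, hw⟩ := KuhnAux.places hTR hTI hquad conj m σ hσ nm hnm
  have hpos : ∀ j (β : F), β ≠ 0 → 0 < σ j (nm β) := by
    intro j β hβ
    rw [hw]
    exact pow_pos ((InfinitePlace.pos_iff (w := w j)).2 hβ) 2
  have hu0 : ∀ u : (𝓞 F)ˣ, ((u : 𝓞 F) : F) ≠ 0 := fun u => NumberField.Units.coe_ne_zero u
  let ℓ : Fin (m + 1) → (𝓞 F)ˣ →* Multiplicative ℝ := fun j =>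
    { toFun := fun u => Multiplicative.ofAdd (2 * Real.log (w j (u : F)))
      map_one' := by simp
      map_mul' := by
        intro a b
        rw [← ofAdd_add, ← mul_add, ← Real.log_mul]
        · simp
        · simp
        · simp }
  have hℓ : ∀ j u, (ℓ j u).toAdd = 2 * Real.log (w j ((u : 𝓞 F) : F)) := fun j u => rfl
  have hM := KuhnAux.indep m w hmult g hgen ℓ hℓ
  have hexp : ∀ j (u : (𝓞 F)ˣ), σ j (nm ((u : 𝓞 F) : F)) = Real.exp (ℓ j u).toAdd := by
    intro j u
    have hp : 0 < w j ((u : 𝓞 F) : F) := (InfinitePlace.pos_iff (w := w j)).2 (hu0 u)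
    rw [hℓ, hw, two_mul, Real.exp_add, Real.exp_log hp, sq]
  have hprod1 : ∀ u : (𝓞 F)ˣ, ∏ j, σ j (nm ((u : 𝓞 F) : F)) = 1 := by
    intro u
    simp only [hexp]
    rw [← Real.exp_sum, Real.exp_eq_one_iff, ← NumberField.Units.sum_mult_mul_log u,
      ← Equiv.sum_comp w]
    refine Finset.sum_congr rfl fun j _ => ?_
    rw [hℓ, hmult]; rfl
  set L : Fin m → Fin (m + 1) → ℝ := fun i j => (ℓ j (g i)).toAdd with hL
  obtain ⟨x, hx, hxmin⟩ := hmin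
  have hα' : (α : F) ≠ 0 := by simpa using hα
  set c := weightedNorm σ nm x (α : F) with hc
  have hcpos : 0 < c := by
    rw [hc, weightedNorm]
    exact Finset.sum_pos (fun j _ => mul_pos (hx j) (hpos j _ hα')) Finset.univ_nonempty
  have hm1 : (0 : ℝ) < (m : ℝ) + 1 := by positivity
  set P : Fin (m + 1) → ℝ := fun j => c / (((m : ℝ) + 1) * x j) with hP
  have hPpos : ∀ j, 0 < P j := fun j => div_pos hcpos (mul_pos hm1 (hx j))
  obtain ⟨z, s, q, t, ht, hq, hzq⟩ := KuhnAux.ray L hM P hPpos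
  -- vertices as images of units
  have hvert : ∀ (r : Fin (m + 1)) j,
      ∏ l ∈ Finset.univ.filter (fun l : Fin m => (l : ℕ) < (r : ℕ)), Real.exp (L (s l) j) =
      σ j (nm (((∏ l ∈ Finset.univ.filter (fun l : Fin m => (l : ℕ) < (r : ℕ)), g (s l) :
        (𝓞 F)ˣ) : 𝓞 F) : F)) := by
    intro r j
    rw [hexp, map_prod, toAdd_prod, Real.exp_sum]
  have hset : (fun r : Fin (m + 1) => fun j =>
      ∏ l ∈ Finset.univ.filter (fun l : Fin m => (l : ℕ) < (r : ℕ)), Real.exp (L (s l) j)) =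
      simplexVertex σ nm g s := by
    funext r j
    rw [hvert, simplexVertex, SigmaMap]
    congr 2
    simp
  have hEz : ∀ j, KuhnAux.E L z j = σ j (nm (((∏ i, g i ^ z i : (𝓞 F)ˣ) : 𝓞 F) : F)) := by
    intro j
    rw [hexp, map_prod, toAdd_prod, KuhnAux.E]
    congr 1
    refine Finset.sum_congr rfl fun i _ => ?_
    rw [map_zpow, toAdd_zpow, zsmul_eq_mul]
  -- the simplex lies above the hyperplane
  have hhalf : c ≤ ∑ j, x j * KuhnAux.E L z j * q j := by
    have hsub : convexHull ℝ (Set.range fun r : Fin (m + 1) => fun j =>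
      ∏ l ∈ Finset.univ.filter (fun l : Fin m => (l : ℕ) < (r : ℕ)), Real.exp (L (s l) j)) ⊆
        {p : Fin (m + 1) → ℝ | c ≤ ∑ j, x j * KuhnAux.E L z j * p j} := by
      refine convexHull_min ?_ (convex_halfSpace_ge ⟨?_, ?_⟩ c)
      · rintro _ ⟨r, rfl⟩
        have := hxmin (((∏ i, g i ^ z i) * ∏ l ∈ Finset.univ.filter
          (fun l : Fin m => (l : ℕ) < (r : ℕ)), g (s l) : (𝓞 F)ˣ) : 𝓞 F) (Units.ne_zero _)
        refine this.trans (le_of_eq ?_)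
        rw [weightedNorm]
        refine Finset.sum_congr rfl fun j _ => ?_
        change _ = x j * KuhnAux.E L z j * ∏ l ∈ Finset.univ.filter
          (fun l : Fin m => (l : ℕ) < (r : ℕ)), Real.exp (L (s l) j)
        rw [hvert, hEz, mul_assoc, hexp, hexp, hexp, ← Real.exp_add, ← toAdd_mul, ← map_mul]
      · intro p p'
        simp only [Pi.add_apply, mul_add, Finset.sum_add_distrib]
      · intro a p
        simp only [Pi.smul_apply, smul_eq_mul, Finset.mul_sum]
        exact Finset.sum_congr rfl fun j _ => by ring
    exact hsub hq
  have ht1 : 1 ≤ t := by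
    have e : ∑ j, x j * KuhnAux.E L z j * q j = t * c := by
      have : ∀ j, x j * KuhnAux.E L z j * q j = t * (c / ((m : ℝ) + 1)) := by
        intro j
        rw [mul_assoc, hzq, hP]
        have := (hx j).ne'
        field_simp
      simp only [this, Finset.sum_const, Finset.card_univ, Fintype.card_fin, nsmul_eq_mul]
      push_cast
      field_simp
    rw [e] at hhalf
    by_contra hcon
    nlinarith
  have hNP : fieldNormQ σ nm (α : F) ≤ ∏ j, P j := by
    have h1 := KuhnAux.amgm (fun j => σ j (nm (α : F)) / P j)
      (fun j => (div_pos (hpos j _ hα') (hPpos j)).le) (by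
        have e : ∀ j, σ j (nm (α : F)) / P j = (((m : ℝ) + 1) / c) * (x j * σ j (nm (α : F))) := by
          intro j
          rw [hP]
          have := (hx j).ne'
          field_simp
        simp only [e]
        rw [← Finset.mul_sum, ← weightedNorm, ← hc, div_mul_cancel₀ _ hcpos.ne']
        push_cast; rfl)
    rw [Finset.prod_div_distrib, div_le_one (Finset.prod_pos fun j _ => hPpos j)] at h1
    exact h1
  have hqprod : ∏ j, P j ≤ ∏ j, q j := by
    have e1 : ∏ j, KuhnAux.E L z j = 1 := by simp only [hEz]; exact hprod1 _
    have e2 : ∏ j, q j = ∏ j, (t * P j) := by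
      rw [← one_mul (∏ j, q j), ← e1, ← Finset.prod_mul_distrib]
      exact Finset.prod_congr rfl fun j _ => hzq j
    rw [e2]
    refine Finset.prod_le_prod (fun j _ => (hPpos j).le) fun j _ => ?_
    nlinarith [hPpos j]
  rw [hset] at hq
  refine (hNP.trans hqprod).trans ?_
  refine le_trans ?_ (Finset.le_sup' _ (Finset.mem_univ s))
  refine le_csSup ?_ ⟨q, hq, rfl⟩
  have hcomp : IsCompact (convexHull ℝ (Set.range (simplexVertex σ nm g s))) :=
    (Set.finite_range _).isCompact_convexHull (𝕜 := ℝ)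
  exact (hcomp.image (continuous_finsetProd _ fun j _ => continuous_apply j)).bddAbove
end

section
/- Let F be a CM number field with maximal totally real subfield K of degree k over ℚ, and fix positive weights x_1, …, x_k. Then for every t > 0 the series ψ(t) = Σ_{α ∈ O_F} exp(−tπ⟨α,α⟩_x) converges, and, writing μ = min{⟨α,α⟩_x : α ∈ O_F, α ≠ 0} and n = #{α ∈ O_F : ⟨α,α⟩_x = μ}, one has e^{tπμ}·(ψ(t) − 1) → n as t → ∞; equivalently, ψ(t) = 1 + n·e^{−tπμ} + o(e^{−tπμ}). -/
open NumberField Finset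

/-- Every complex embedding of `F` intertwines `conj` and complex conjugation. -/
theorem cm_conj_embedding {F K : Type*} [Field F] [Field K] [Algebra K F]
    (hTR : ∀ τ : K →+* ℂ, ∀ x : K, (τ x).im = 0)
    (hTI : IsEmpty (F →+* ℝ)) (conj : F ≃ₐ[K] F)
    (nm : F → K) (hnm : ∀ α : F, algebraMap K F (nm α) = α * conj α)
    (φ : F →+* ℂ) (α : F) : φ (conj α) = (starRingEnd ℂ) (φ α) := by
  have hK : ∀ a : K, (starRingEnd ℂ) (φ (algebraMap K F a)) = φ (algebraMap K F a) := fun a =>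
    Complex.conj_eq_iff_im.2 (hTR (φ.comp (algebraMap K F)) a)
  have hor : ∀ a : F, (starRingEnd ℂ) (φ a) = φ a ∨ (starRingEnd ℂ) (φ a) = φ (conj a) := by
    intro a
    have hn : (starRingEnd ℂ) (φ a) * (starRingEnd ℂ) (φ (conj a)) = φ a * φ (conj a) := by
      have := hK (nm a)
      rwa [hnm, map_mul, map_mul] at this
    have ht : (starRingEnd ℂ) (φ a) + (starRingEnd ℂ) (φ (conj a)) = φ a + φ (conj a) := by
      have := hK (nm (1 + a))
      rw [hnm] at this
      simp only [map_mul, map_add, map_one] at this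
      linear_combination this - hn
    have : ((starRingEnd ℂ) (φ a) - φ a) * ((starRingEnd ℂ) (φ a) - φ (conj a)) = 0 := by
      linear_combination (starRingEnd ℂ) (φ a) * ht - hn
    rcases mul_eq_zero.1 this with h | h
    · exact Or.inl (sub_eq_zero.1 h)
    · exact Or.inr (sub_eq_zero.1 h)
  have hex : ∃ β : F, (starRingEnd ℂ) (φ β) ≠ φ β := by
    by_contra! h
    have hφ : NumberField.ComplexEmbedding.IsReal φ := by
      rw [NumberField.ComplexEmbedding.isReal_iff]
      ext a
      simpa using h a
    exact hTI.false hφ.embedding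
  obtain ⟨β, hβ⟩ := hex
  have hβ2 := (hor β).resolve_left hβ
  by_contra hne
  have hα := (hor α).resolve_right (fun h => hne h.symm)
  rcases hor (α + β) with h | h
  · simp only [map_add] at h
    apply hβ
    linear_combination h - hα
  · simp only [map_add] at h
    apply hne
    linear_combination hβ2 - h

theorem cm_norm_sq {F K : Type*} [Field F] [Field K] [Algebra K F]
    (hTR : ∀ τ : K →+* ℂ, ∀ x : K, (τ x).im = 0)
    (hTI : IsEmpty (F →+* ℝ)) (conj : F ≃ₐ[K] F)
    (nm : F → K) (hnm : ∀ α : F, algebraMap K F (nm α) = α * conj α)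
    (φ : F →+* ℂ) (s : K →+* ℝ) (hs : ∀ a, φ (algebraMap K F a) = (s a : ℂ)) (α : F) :
    s (nm α) = ‖φ α‖ ^ 2 := by
  have h := hs (nm α)
  rw [hnm, map_mul, cm_conj_embedding hTR hTI conj nm hnm, Complex.mul_conj'] at h
  exact_mod_cast h.symm

theorem cm_weighted_lower {F K : Type*} [Field F] [Field K] [NumberField F] [NumberField K]
    [Algebra K F]
    (hTR : ∀ τ : K →+* ℂ, ∀ x : K, (τ x).im = 0)
    (hTI : IsEmpty (F →+* ℝ)) (conj : F ≃ₐ[K] F) (m : ℕ)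
    (σ : Fin (m + 1) → (K →+* ℝ)) (hσ : Function.Bijective σ)
    (nm : F → K) (hnm : ∀ α : F, algebraMap K F (nm α) = α * conj α)
    (x : Fin (m + 1) → ℝ) (hx : ∀ j, 0 < x j) :
    ∃ c : ℝ, 0 < c ∧ ∀ (α : F) (φ : F →+* ℂ), c * ‖φ α‖ ^ 2 ≤ weightedNorm σ nm x α := by
  haveI : Algebra.IsAlgebraic K F := Algebra.IsAlgebraic.tower_top (K := ℚ) K
  have hnn : ∀ j α, 0 ≤ σ j (nm α) := by
    intro j α
    letI : Algebra K ℂ := (Complex.ofRealHom.comp (σ j)).toAlgebra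
    let ψ : F →ₐ[K] ℂ := IsAlgClosed.lift
    rw [cm_norm_sq hTR hTI conj nm hnm ψ.toRingHom (σ j) (fun a => ψ.commutes a) α]
    positivity
  obtain ⟨j0, hj0⟩ := Finite.exists_min x
  refine ⟨x j0, hx j0, fun α φ => ?_⟩
  have hreal : NumberField.ComplexEmbedding.IsReal (φ.comp (algebraMap K F)) := by
    rw [NumberField.ComplexEmbedding.isReal_iff]
    ext a
    simpa using Complex.conj_eq_iff_im.2 (hTR (φ.comp (algebraMap K F)) a)
  obtain ⟨j, hj⟩ := hσ.2 hreal.embedding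
  have h1 : σ j (nm α) = ‖φ α‖ ^ 2 := by
    refine cm_norm_sq hTR hTI conj nm hnm φ (σ j) (fun a => ?_) α
    rw [hj]
    simp
  rw [← h1]
  calc x j0 * σ j (nm α) ≤ x j * σ j (nm α) := mul_le_mul_of_nonneg_right (hj0 j) (hnn j α)
    _ ≤ _ := Finset.single_le_sum (f := fun j => x j * σ j (nm α))
      (fun i _ => mul_nonneg (hx i).le (hnn i α)) (Finset.mem_univ j)

theorem summable_exp_of_lower {F : Type*} [Field F] [NumberField F] (q : F → ℝ) (c : ℝ)
    (hc : 0 < c) (hq : ∀ (α : F) (φ : F →+* ℂ), c * ‖φ α‖ ^ 2 ≤ q α) (s : ℝ) (hs : 0 < s) :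
    Summable fun α : 𝓞 F => Real.exp (-s * q (α : F)) := by
  classical
  let L := mixedEmbedding.integerLattice F
  let e : 𝓞 F → L := fun α => ⟨mixedEmbedding F (α : F), ⟨α, rfl⟩⟩
  have he : Function.Injective e := by
    intro a b hab
    have := congrArg Subtype.val hab
    exact RingOfIntegers.ext ((mixedEmbedding F).injective this)
  let M := Module.finrank ℤ L + 1
  have hsum := (ZLattice.summable_norm_pow_inv L (2 * M) (by omega)).comp_injective he
  have hsum2 := hsum.mul_left ((M.factorial : ℝ) / (s * c) ^ M)
  refine Summable.of_norm_bounded_eventually hsum2 ?_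
  have hfin : ({(0 : 𝓞 F)} : Set (𝓞 F)).Finite := Set.finite_singleton 0
  filter_upwards [hfin.compl_mem_cofinite] with α hα
  have hα0 : α ≠ 0 := hα
  have hN : 0 < ‖e α‖ := by
    rw [norm_pos_iff]
    intro h0
    apply hα0
    apply he
    rw [h0]
    ext1
    simp [e]
  have hle : c * ‖e α‖ ^ 2 ≤ q α := by
    have : ∃ w : InfinitePlace F, ‖e α‖ = w (α : F) := by
      have h := mixedEmbedding.norm_eq_sup'_normAtPlace (mixedEmbedding F (α : F))
      obtain ⟨w, -, hw⟩ := Finset.exists_mem_eq_sup' (Finset.univ_nonempty)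
        (fun w : InfinitePlace F => mixedEmbedding.normAtPlace w (mixedEmbedding F (α : F)))
      refine ⟨w, ?_⟩
      rw [hw, mixedEmbedding.normAtPlace_apply] at h
      exact h
    obtain ⟨w, hw⟩ := this
    rw [hw, ← InfinitePlace.norm_embedding_eq]
    exact hq _ _
  have hy : 0 < s * c * ‖e α‖ ^ 2 := by positivity
  have h1 := Real.pow_div_factorial_le_exp _ hy.le M
  have hf : (0 : ℝ) < M.factorial := by exact_mod_cast M.factorial_pos
  rw [Real.norm_of_nonneg (Real.exp_pos _).le]
  calc Real.exp (-s * q α) ≤ Real.exp (-(s * c * ‖e α‖ ^ 2)) := by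
        apply Real.exp_le_exp.2
        nlinarith
    _ = (Real.exp (s * c * ‖e α‖ ^ 2))⁻¹ := Real.exp_neg _
    _ ≤ ((s * c * ‖e α‖ ^ 2) ^ M / M.factorial)⁻¹ := inv_anti₀ (by positivity) h1
    _ = _ := by
        simp only [Function.comp]
        rw [mul_pow (s * c), ← pow_mul, inv_pow]
        field_simp

theorem cusp_limit {A : Type*} [AddCommGroup A] [Nontrivial A] (q : A → ℝ) (h0 : q 0 = 0)
    (hpos : ∀ a, a ≠ 0 → 0 < q a)
    (hsum : ∀ s : ℝ, 0 < s → Summable fun a : A => Real.exp (-s * q a))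
    (μ : ℝ) (hμ : μ = sInf {r : ℝ | ∃ a : A, a ≠ 0 ∧ q a = r}) :
    Filter.Tendsto (fun t : ℝ => Real.exp (t * Real.pi * μ) *
        ((∑' a : A, Real.exp (-(t * Real.pi) * q a)) - 1))
      Filter.atTop (nhds (Set.ncard {a : A | q a = μ} : ℝ)) := by
  classical
  have hfin : ∀ R : ℝ, {a : A | q a ≤ R}.Finite := by
    intro R
    have h := (hsum 1 one_pos).tendsto_cofinite_zero
    have h2 := h.eventually (gt_mem_nhds (Real.exp_pos (-1 * R)))
    rw [Filter.eventually_cofinite] at h2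
    refine h2.subset fun a ha => ?_
    have : q a ≤ R := ha
    simp only [Set.mem_setOf_eq, not_lt]
    apply Real.exp_le_exp.2
    linarith
  obtain ⟨a1, ha1⟩ := exists_ne (0 : A)
  have hmin : ∃ b : A, b ≠ 0 ∧ ∀ a, a ≠ 0 → q b ≤ q a := by
    obtain ⟨b, hb, hb2⟩ := Set.exists_min_image ({a : A | q a ≤ q a1} \ {0}) q
      ((hfin _).subset Set.diff_subset) ⟨a1, by simpa using ha1⟩
    refine ⟨b, hb.2, fun a ha => ?_⟩
    by_cases h : q a ≤ q a1
    · exact hb2 a ⟨h, ha⟩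
    · exact (show q b ≤ q a1 from hb.1).trans (not_le.1 h).le
  obtain ⟨b, hb0, hb⟩ := hmin
  have hμb : μ = q b := by
    rw [hμ]
    refine IsLeast.csInf_eq ⟨⟨b, hb0, rfl⟩, ?_⟩
    rintro r ⟨a, ha, rfl⟩
    exact hb a ha
  have hμpos : 0 < μ := hμb ▸ hpos b hb0
  have hμle : ∀ a, a ≠ 0 → μ ≤ q a := fun a ha => hμb ▸ hb a ha
  have hSfin : {a : A | q a = μ}.Finite := (hfin μ).subset fun a ha => le_of_eq ha
  have hlim : ((Set.ncard {a : A | q a = μ} : ℕ) : ℝ) = ∑' a : A, if q a = μ then (1 : ℝ) else 0 := by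
    rw [tsum_eq_sum (s := hSfin.toFinset) (by
      intro a ha
      rw [if_neg]
      simpa using ha)]
    rw [Set.ncard_eq_toFinset_card _ hSfin, Finset.sum_congr rfl (g := fun _ => (1 : ℝ))]
    · simp
    · intro a ha
      rw [if_pos]
      simpa using ha
  rw [hlim]
  have hD : Filter.Tendsto (fun t : ℝ => ∑' a : A, if a = 0 then 0 else
      Real.exp (-(t * Real.pi) * (q a - μ))) Filter.atTop
      (nhds (∑' a : A, if q a = μ then (1 : ℝ) else 0)) := by
    refine tendsto_tsum_of_dominated_convergence
      (bound := fun a => Real.exp (Real.pi * μ) * Real.exp (-Real.pi * q a))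
      ((hsum _ Real.pi_pos).mul_left _) ?_ ?_
    · intro a
      by_cases ha : a = 0
      · have : ¬ (q a = μ) := by rw [ha, h0]; exact hμpos.ne
        simp only [if_pos ha, if_neg this]
        exact tendsto_const_nhds
      · simp only [if_neg ha]
        by_cases hqa : q a = μ
        · simp [hqa]
        · rw [if_neg hqa]
          have hlt : 0 < q a - μ := sub_pos.2 (lt_of_le_of_ne (hμle a ha) (Ne.symm hqa))
          have hp : 0 < Real.pi * (q a - μ) := mul_pos Real.pi_pos hlt
          have := Real.tendsto_exp_neg_atTop_nhds_zero.comp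
            (Filter.tendsto_id.atTop_mul_const hp)
          refine this.congr fun t => ?_
          simp only [Function.comp, id]
          congr 1
          ring
    · filter_upwards [Filter.eventually_ge_atTop (1 : ℝ)] with t ht a
      by_cases ha : a = 0
      · simp only [if_pos ha, norm_zero]
        positivity
      · simp only [if_neg ha]
        rw [Real.norm_of_nonneg (Real.exp_pos _).le, ← Real.exp_add]
        apply Real.exp_le_exp.2
        have h1 : 0 ≤ Real.pi * (q a - μ) :=
          mul_nonneg Real.pi_pos.le (sub_nonneg.2 (hμle a ha))
        nlinarith
  refine hD.congr' ?_
  filter_upwards [Filter.eventually_gt_atTop (0 : ℝ)] with t ht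
  rw [(hsum (t * Real.pi) (mul_pos ht Real.pi_pos)).tsum_eq_add_tsum_ite 0, h0, mul_zero,
    Real.exp_zero, add_sub_cancel_left, ← tsum_mul_left]
  refine tsum_congr fun a => ?_
  by_cases ha : a = 0
  · simp [ha]
  · simp only [if_neg ha]
    rw [← Real.exp_add]
    congr 1
    ring

theorem psi_cusp_asymptotics
    {F K : Type*} [Field F] [Field K] [NumberField F] [NumberField K] [Algebra K F]
    -- `K` is totally real
    (hTR : ∀ τ : K →+* ℂ, ∀ x : K, (τ x).im = 0)
    -- `F` is totally imaginary
    (hTI : IsEmpty (F →+* ℝ))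
    -- `F/K` is quadratic, so `F` is a CM field with maximal totally real subfield `K`
    (hquad : Module.finrank K F = 2)
    -- complex conjugation: the nontrivial element of `Gal(F/K)`
    (conj : F ≃ₐ[K] F) (hconj : conj ≠ AlgEquiv.refl)
    -- `k = m + 1` is the degree of `K` over `ℚ`
    (m : ℕ) (hk : Module.finrank ℚ K = m + 1)
    -- the `k` real embeddings of `K`
    (σ : Fin (m + 1) → (K →+* ℝ)) (hσ : Function.Bijective σ)
    -- the relative norm `α ↦ α·conj α`, valued in `K`
    (nm : F → K) (hnm : ∀ α : F, algebraMap K F (nm α) = α * conj α)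
    -- fixed positive weights
    (x : Fin (m + 1) → ℝ) (hx : ∀ j, 0 < x j)
    -- `μ` is the minimal weighted norm of a nonzero element, attained `n` times
    (μ : ℝ) (hμ : μ = sInf {r : ℝ | ∃ α : 𝓞 F, α ≠ 0 ∧ weightedNorm σ nm x (α : F) = r})
    (n : ℕ) (hn : n = Set.ncard {α : 𝓞 F | weightedNorm σ nm x (α : F) = μ}) :
    (∀ t : ℝ, 0 < t →
      Summable fun α : 𝓞 F => Real.exp (-(t * Real.pi) * weightedNorm σ nm x (α : F))) ∧
    Filter.Tendsto
      (fun t : ℝ => Real.exp (t * Real.pi * μ) *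
        ((∑' α : 𝓞 F, Real.exp (-(t * Real.pi) * weightedNorm σ nm x (α : F))) - 1))
      Filter.atTop (nhds (n : ℝ)) := by
  obtain ⟨c, hc, hq⟩ := cm_weighted_lower hTR hTI conj m σ hσ nm hnm x hx
  have hsum := summable_exp_of_lower (weightedNorm σ nm x) c hc hq
  refine ⟨fun t ht => hsum _ (mul_pos ht Real.pi_pos), ?_⟩
  rw [hn]
  refine cusp_limit (fun α : 𝓞 F => weightedNorm σ nm x (α : F)) ?_ ?_ hsum μ hμ
  · have h0 : nm 0 = 0 := by
      apply (algebraMap K F).injective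
      rw [hnm]
      simp
    simp [weightedNorm, h0]
  · intro α hα
    obtain ⟨φ⟩ := (inferInstance : Nonempty (F →+* ℂ))
    refine lt_of_lt_of_le ?_ (hq (α : F) φ)
    have h1 : (α : F) ≠ 0 := by
      simpa using hα
    have : 0 < ‖φ (α : F)‖ := norm_pos_iff.2 ((map_ne_zero φ).2 h1)
    positivity
end
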